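/- Let n ≥ 1, 0 ≤ k ≤ n, and r ≥ 1. The pullback map Φ^* restricts to a linear isomorphism from P̊_r^-Λ^k(T^n) onto u_N *_{S^n}P_{2r+k-n-2}Λ^{n-k}_e(S^n), the space of forms u_N *_{S^n}γ with γ an even form in P_{2r+k-n-2}Λ^{n-k}(S^n). -/

import Mathlib

open scoped BigOperators
open MeasureTheory

noncomputable section

/-- Vectors in `ℝ^m`. -/
abbrev Vec (m : ℕ) := Fin m → ℝ

/-- Differential `k`-forms on `ℝ^m`, given pointwise as alternating `k`-tensors. -/
abbrev Form (m k : ℕ) := Vec m → (Vec m [⋀^Fin k]→ₗ[ℝ] ℝ)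

/-- A multivariate polynomial has (total) degree at most `r : ℤ`. -/
def degLE {m : ℕ} (r : ℤ) (p : MvPolynomial (Fin m) ℝ) : Prop :=
  ∀ d ∈ p.support, ((d.sum fun _ e => e : ℕ) : ℤ) ≤ r

/-- `P_rΛ^k(ℝ^m)`: differential `k`-forms with polynomial coefficients of degree at most `r`. -/
def PL (m k : ℕ) (r : ℤ) : Set (Form m k) :=
  {α | ∀ v : Fin k → Vec m, ∃ p : MvPolynomial (Fin m) ℝ,
      degLE r p ∧ ∀ x, α x v = MvPolynomial.eval x p}

/-- Interior product with the radial vector field `X = Σ xᵢ ∂/∂xᵢ`. -/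
def iU {m k : ℕ} (β : Form m (k + 1)) : Form m k := fun x => (β x).curryLeft x

/-- `P_r⁻Λ^k(ℝ^m) := i_X P_{r-1}Λ^{k+1}(ℝ^m)`. -/
def PLm (m k : ℕ) (r : ℤ) : Set (Form m k) := iU '' PL m (k + 1) (r - 1)

/-- The reflection negating the `i`-th coordinate, as a map. -/
def reflFun (m : ℕ) (i : Fin m) (u : Vec m) : Vec m := fun j => if j = i then -u j else u j

/-- The reflection negating the `i`-th coordinate, as a linear map. -/
def reflLin (m : ℕ) (i : Fin m) : Vec m →ₗ[ℝ] Vec m :=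
  LinearMap.pi fun j => if j = i then -LinearMap.proj j else LinearMap.proj j

/-- Pullback of an ambient form along the reflection `R_i`. -/
def reflPull (m k : ℕ) (i : Fin m) (α : Form m k) : Form m k :=
  fun x => (α (reflFun m i x)).compLinearMap (reflLin m i)

/-- A form on `ℝ^m` is even if it is invariant under all coordinate reflections. -/
def IsEven (m k : ℕ) (α : Form m k) : Prop := ∀ i, reflPull m k i α = α

/-- A form on `ℝ^m` is odd if every coordinate reflection negates it. -/
def IsOdd (m k : ℕ) (α : Form m k) : Prop := ∀ i, reflPull m k i α = -α

/-- The map `Φ(u) = (u₁², …, u_m²)`. -/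
def Phi (m : ℕ) (u : Vec m) : Vec m := fun i => u i ^ 2

/-- The differential of `Φ` at `u`. -/
def dPhi (m : ℕ) (u : Vec m) : Vec m →ₗ[ℝ] Vec m :=
  LinearMap.pi fun i => (2 * u i) • LinearMap.proj i

/-- Pullback of ambient forms along `Φ`. -/
def phiPull (m k : ℕ) (α : Form m k) : Form m k :=
  fun u => (α (Phi m u)).compLinearMap (dPhi m u)

/-- The standard simplex `T^{m-1} ⊂ ℝ^m`. -/
def simplexSet (m : ℕ) : Set (Vec m) := {x | (∀ i, 0 ≤ x i) ∧ ∑ i, x i = 1}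

/-- The unit sphere `S^{m-1} ⊂ ℝ^m`. -/
def sphereSet (m : ℕ) : Set (Vec m) := {u | ∑ i, u i ^ 2 = 1}

/-- The linear functional `v ↦ ⟨u, v⟩`. -/
def dotLin (m : ℕ) (u : Vec m) : Vec m →ₗ[ℝ] ℝ := ∑ i, u i • LinearMap.proj i

/-- Orthogonal projection onto the tangent space of the sphere at `u`. -/
def projSph (m : ℕ) (u : Vec m) : Vec m →ₗ[ℝ] Vec m :=
  LinearMap.id - (dotLin m u).smulRight u

/-- The linear functional `v ↦ Σ vᵢ`. -/
def sumLin (m : ℕ) : Vec m →ₗ[ℝ] ℝ := ∑ i, LinearMap.proj i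

/-- Orthogonal projection onto the tangent hyperplane `{Σ vᵢ = 0}` of the simplex. -/
def projSim (m : ℕ) : Vec m →ₗ[ℝ] Vec m :=
  LinearMap.id - ((m : ℝ)⁻¹ • sumLin m).smulRight (fun _ => 1)

/-- Differential `k`-forms on a subset `M ⊆ ℝ^m`, encoded at each point by the canonical
alternating tensor on `ℝ^m` that vanishes in the directions normal to `M` (i.e. the
pullback along the inclusion, extended by the tangent projection). -/
abbrev FormOn (m : ℕ) (M : Set (Vec m)) (k : ℕ) := M → (Vec m [⋀^Fin k]→ₗ[ℝ] ℝ)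

/-- Restriction (pullback along the inclusion) of an ambient form to the simplex. -/
def resSim (m k : ℕ) (α : Form m k) : FormOn m (simplexSet m) k :=
  fun x => (α x.1).compLinearMap (projSim m)

/-- Restriction (pullback along the inclusion) of an ambient form to the sphere. -/
def resSph (m k : ℕ) (α : Form m k) : FormOn m (sphereSet m) k :=
  fun u => (α u.1).compLinearMap (projSph m u.1)

/-- `P_rΛ^k(T^{m-1})`. -/
def PLsim (m k : ℕ) (r : ℤ) : Set (FormOn m (simplexSet m) k) := resSim m k '' PL m k r

/-- `P_rΛ^k(S^{m-1})`. -/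
def PLsph (m k : ℕ) (r : ℤ) : Set (FormOn m (sphereSet m) k) := resSph m k '' PL m k r

/-- `P_r⁻Λ^k(T^{m-1})`. -/
def PLmsim (m k : ℕ) (r : ℤ) : Set (FormOn m (simplexSet m) k) := resSim m k '' PLm m k r

/-- `P_r⁻Λ^k(S^{m-1})`. -/
def PLmsph (m k : ℕ) (r : ℤ) : Set (FormOn m (sphereSet m) k) := resSph m k '' PLm m k r

lemma phi_mem_simplex {m : ℕ} {u : Vec m} (hu : u ∈ sphereSet m) :
    Phi m u ∈ simplexSet m :=
  ⟨fun _ => sq_nonneg _, hu⟩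

/-- Pullback `Φ^* : Λ^k(T^{m-1}) → Λ^k(S^{m-1})` along `Φ : S^{m-1} → T^{m-1}`. -/
def phiPullTS (m k : ℕ) (a : FormOn m (simplexSet m) k) : FormOn m (sphereSet m) k :=
  fun u => (a ⟨Phi m u.1, phi_mem_simplex u.2⟩).compLinearMap
    ((dPhi m u.1).comp (projSph m u.1))

lemma refl_mem_sphere {m : ℕ} {i : Fin m} {u : Vec m} (hu : u ∈ sphereSet m) :
    reflFun m i u ∈ sphereSet m := by
  have : ∀ j, (reflFun m i u j) ^ 2 = u j ^ 2 := by
    intro j; simp only [reflFun]; split <;> ring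
  simpa only [sphereSet, Set.mem_setOf_eq, this] using hu

/-- Pullback of a form on the sphere along the reflection `R_i`. -/
def reflPullSph (m k : ℕ) (i : Fin m) (α : FormOn m (sphereSet m) k) :
    FormOn m (sphereSet m) k :=
  fun u => (α ⟨reflFun m i u.1, refl_mem_sphere u.2⟩).compLinearMap (reflLin m i)

/-- A form on the sphere is even if it is invariant under all coordinate reflections. -/
def IsEvenSph (m k : ℕ) (α : FormOn m (sphereSet m) k) : Prop :=
  ∀ i, reflPullSph m k i α = α

/-- A form on the sphere is odd if every coordinate reflection negates it. -/
def IsOddSph (m k : ℕ) (α : FormOn m (sphereSet m) k) : Prop :=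
  ∀ i, reflPullSph m k i α = -α

/-- The bubble function `u_N = u₁ ⋯ u_m`. -/
def bubble (m : ℕ) (u : Vec m) : ℝ := ∏ i, u i

/-- Multiplication of a form on the sphere by the bubble function. -/
def bubbleSmul (m k : ℕ) (α : FormOn m (sphereSet m) k) : FormOn m (sphereSet m) k :=
  fun u => bubble m u.1 • α u

/-- Multiplication of an ambient form by the bubble function. -/
def bubbleSmulAmb (m k : ℕ) (α : Form m k) : Form m k :=
  fun u => bubble m u • α u

/-- The standard volume form on `ℝ^m`. -/
def volForm (m : ℕ) : (Vec m) [⋀^Fin m]→ₗ[ℝ] ℝ := (Pi.basisFun ℝ (Fin m)).det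

/-- Iterated interior product: insert the vectors `v 0, …, v (k-1)` into the
first `k` slots of an alternating `(k+j)`-tensor. -/
def contrMany {m : ℕ} : (k : ℕ) → (Fin k → Vec m) → {j : ℕ} →
    ((Vec m) [⋀^Fin (k + j)]→ₗ[ℝ] ℝ) → ((Vec m) [⋀^Fin j]→ₗ[ℝ] ℝ)
  | 0, _, j, α => α.domDomCongr (finCongr (Nat.zero_add j))
  | (k + 1), v, j, α =>
      contrMany k (fun i => v i.succ)
        ((α.domDomCongr (finCongr (by omega : (k + 1) + j = (k + j) + 1))).curryLeft (v 0))

/-- The Hodge star on alternating tensors on `ℝ^m` (standard metric and orientation):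
`(⋆α)(w₁,…,w_{m-k}) = (1/k!) Σ_g α(e_{g 0},…,e_{g(k-1)}) vol(e_{g 0},…,e_{g(k-1)},w₁,…,w_{m-k})`. -/
def starAlt (m k : ℕ) (α : (Vec m) [⋀^Fin k]→ₗ[ℝ] ℝ) : (Vec m) [⋀^Fin (m - k)]→ₗ[ℝ] ℝ :=
  if h : k ≤ m then
    (k.factorial : ℝ)⁻¹ •
      ∑ g : Fin k → Fin m,
        α (fun i => Pi.single (g i) 1) •
          contrMany k (fun i => Pi.single (g i) 1)
            ((volForm m).domDomCongr (finCongr (by omega : m = k + (m - k))))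
  else 0

/-- The Hodge star `⋆_{ℝ^m}` applied pointwise to ambient forms. -/
def starR (m k : ℕ) (α : Form m k) : Form m (m - k) := fun x => starAlt m k (α x)

/-- The wedge product of alternating tensors. -/
def wedgeAlt {m k l : ℕ} (α : (Vec m) [⋀^Fin k]→ₗ[ℝ] ℝ) (β : (Vec m) [⋀^Fin l]→ₗ[ℝ] ℝ) :
    (Vec m) [⋀^Fin (k + l)]→ₗ[ℝ] ℝ :=
  ((TensorProduct.lid ℝ ℝ).toLinearMap.compAlternatingMap (α.domCoprod β)).domDomCongr
    finSumFinEquiv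

/-- The conormal `ν = Σ uᵢ duᵢ` at `u`, as an alternating 1-tensor. -/
def nuForm (m : ℕ) (u : Vec m) : (Vec m) [⋀^Fin 1]→ₗ[ℝ] ℝ :=
  AlternatingMap.ofSubsingleton ℝ (Vec m) ℝ (0 : Fin 1) (dotLin m u)

/-- The extended Hodge star `⋆_{S^{m-1}} α := ⋆_{ℝ^m}(ν ∧ α)` on ambient forms. -/
def starSphAmb (m k : ℕ) (α : Form m k) : Form m (m - (1 + k)) :=
  fun x => starAlt m (1 + k) (wedgeAlt (nuForm m x) (α x))

/-- The Hodge star of a form on the sphere (w.r.t. the round metric and the orientation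
induced by the outward normal), computed as the restriction of `⋆_{ℝ^m}(ν ∧ ·)`. -/
def starSph (m k : ℕ) (α : FormOn m (sphereSet m) k) :
    FormOn m (sphereSet m) (m - (1 + k)) :=
  fun u => (starAlt m (1 + k) (wedgeAlt (nuForm m u.1) (α u))).compLinearMap (projSph m u.1)

/-- Re-indexing a form along an equality of form degrees. -/
def castForm {m k l : ℕ} (h : k = l) (α : Form m k) : Form m l :=
  fun x => (α x).domDomCongr (finCongr h)

/-- Re-indexing a form on a subset along an equality of form degrees. -/
def castFormOn {m : ℕ} {M : Set (Vec m)} {k l : ℕ} (h : k = l) (α : FormOn m M k) :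
    FormOn m M l :=
  fun x => (α x).domDomCongr (finCongr h)

/-- Trace on the boundary of the simplex vanishes: at every boundary point (a point of some
face `xᵢ = 0`), the form vanishes on vectors tangent to that face. -/
def vanishBdry (m k : ℕ) (a : FormOn m (simplexSet m) k) : Prop :=
  ∀ (x : simplexSet m) (i : Fin m), x.1 i = 0 →
    ∀ v : Fin k → Vec m, (∀ j, (∑ l, v j l) = 0 ∧ v j i = 0) → a x v = 0

/-- `P̊_rΛ^k(T^{m-1})`: forms in `P_rΛ^k(T^{m-1})` with vanishing trace on the boundary. -/
def PLosim (m k : ℕ) (r : ℤ) : Set (FormOn m (simplexSet m) k) :=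
  {a ∈ PLsim m k r | vanishBdry m k a}

/-- `P̊_r⁻Λ^k(T^{m-1})`. -/
def PLmosim (m k : ℕ) (r : ℤ) : Set (FormOn m (simplexSet m) k) :=
  {a ∈ PLmsim m k r | vanishBdry m k a}

/-- A form on the sphere vanishes (as an alternating tensor on the tangent space)
at every point of `S^{m-1} ∩ Γ`, where `Γ = ∪ᵢ {uᵢ = 0}`. -/
def zeroOnGammaSph (m k : ℕ) (α : FormOn m (sphereSet m) k) : Prop :=
  ∀ u : sphereSet m, (∃ i, u.1 i = 0) →
    ∀ v : Fin k → Vec m, (∀ j, ∑ l, u.1 l * v j l = 0) → α u v = 0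

/-- An ambient form vanishes (as an alternating tensor) at every point of `Γ`. -/
def zeroOnGammaAmb (m k : ℕ) (α : Form m k) : Prop :=
  ∀ u : Vec m, (∃ i, u i = 0) → α u = 0

/-- The wedge product of forms on a subset. -/
def wedgeOn {m : ℕ} {M : Set (Vec m)} {k l : ℕ} (a : FormOn m M k) (b : FormOn m M l) :
    FormOn m M (k + l) :=
  fun x => wedgeAlt (a x) (b x)

/-- The base region of the parametrization of the simplex. -/
def baseSimplex (n : ℕ) : Set (Fin n → ℝ) := {y | (∀ j, 0 ≤ y j) ∧ ∑ j, y j ≤ 1}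

/-- Parametrization `y ↦ (1 - Σy, y)` of `T^n` over the base region. -/
def simplexParam (n : ℕ) (y : Fin n → ℝ) : Vec (n + 1) := Fin.cons (1 - ∑ j, y j) y

lemma simplexParam_mem {n : ℕ} {y : Fin n → ℝ} (h : y ∈ baseSimplex n) :
    simplexParam n y ∈ simplexSet (n + 1) := by
  constructor
  · intro i
    refine Fin.cases ?_ ?_ i
    · simpa [simplexParam] using sub_nonneg.mpr h.2
    · intro j; simpa [simplexParam] using h.1 j
  · simp [simplexParam, Fin.sum_cons]

/-- The coordinate tangent vectors `∂x/∂y_j = e_{j+1} - e_0` of the parametrization,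
a positively oriented frame for the orientation of `T^n` induced from the outward-normal
orientation of `S^n` via `Φ`. -/
def simplexTangent (n : ℕ) (j : Fin n) : Vec (n + 1) :=
  Fin.cons (-1) (Pi.single j 1)

open Classical in
/-- The integral of an `n`-form over the oriented simplex `T^n`. -/
def integralSimplex (n : ℕ) (ω : FormOn (n + 1) (simplexSet (n + 1)) n) : ℝ :=
  ∫ y : Fin n → ℝ,
    if h : y ∈ baseSimplex n then ω ⟨simplexParam n y, simplexParam_mem h⟩ (simplexTangent n)
    else 0

/-- Forms on a subset that genuinely are pullbacks to the simplex: they vanish in the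
normal directions (canonical representatives). -/
def TangentialSim (m k : ℕ) (a : FormOn m (simplexSet m) k) : Prop :=
  ∀ x, (a x).compLinearMap (projSim m) = a x

/-- Continuity of a form on a subset. -/
def ContFormOn (m : ℕ) (M : Set (Vec m)) (k : ℕ) (a : FormOn m M k) : Prop :=
  ∀ v : Fin k → Vec m, Continuous fun x : M => a x v

/-- The Riemannian volume form of the round sphere `S^{m-1}` (outward-normal orientation),
i.e. the restriction of `⋆_{ℝ^m} ν`. -/
def volSph (m : ℕ) : FormOn m (sphereSet m) (m - 1) :=
  fun u => (starAlt m 1 (nuForm m u.1)).compLinearMap (projSph m u.1)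

lemma alternatingMap_sum_apply {M N ι κ : Type*} [AddCommGroup M] [Module ℝ M] [AddCommGroup N]
    [Module ℝ N] (s : Finset κ) (F : κ → M [⋀^ι]→ₗ[ℝ] N) (v : ι → M) :
    (∑ a ∈ s, F a) v = ∑ a ∈ s, F a v := by
  classical
  induction s using Finset.induction_on with
  | empty => simp
  | insert a s ha ih => simp [Finset.sum_insert ha, ih]

/-- The standard basis vectors selected by a multi-index. -/
abbrev frame {m : ℕ} {ι : Type*} (g : ι → Fin m) : ι → Vec m := fun i => Pi.single (g i) 1

lemma append_eq_sumElim {p l : ℕ} {β : Type*} (v : Fin p → β) (w : Fin l → β) :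
    Fin.append v w = Sum.elim v w ∘ finSumFinEquiv.symm := by
  funext i
  refine Fin.addCases (fun i => ?_) (fun i => ?_) i <;> simp

lemma append_apply {p l : ℕ} {β : Type*} (v : Fin p → β) (w : Fin l → β) (i : Fin (p + l)) :
    Fin.append v w i = if h : (i : ℕ) < p then v ⟨i, h⟩ else w ⟨i - p, by omega⟩ := by
  refine Fin.addCases (fun i => ?_) (fun i => ?_) i <;> simp

lemma contrMany_apply {m : ℕ} (k : ℕ) : ∀ (v : Fin k → Vec m) {j : ℕ}
    (α : (Vec m) [⋀^Fin (k + j)]→ₗ[ℝ] ℝ) (w : Fin j → Vec m),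
    contrMany k v α w = α (Fin.append v w) := by
  induction k with
  | zero =>
    intro v j α w
    simp only [contrMany, AlternatingMap.domDomCongr_apply]
    congr 1
    funext i
    simp [append_apply]
    rfl
  | succ k ih =>
    intro v j α w
    simp only [contrMany]
    rw [ih, AlternatingMap.curryLeft_apply_apply, AlternatingMap.domDomCongr_apply]
    congr 1
    funext ⟨i, hi⟩
    cases i with
    | zero => simp [append_apply, Matrix.vecCons]
    | succ i =>
      have h2 : (⟨i + 1, by omega⟩ : Fin (k + j + 1)) = Fin.succ ⟨i, by omega⟩ := rfl
      rw [Function.comp_apply, finCongr_apply, Fin.cast_mk, h2, Matrix.vecCons, Fin.cons_succ,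
        append_apply, append_apply]
      by_cases hik : i < k <;> simp [hik]

lemma exists_sign_volForm {m : ℕ} {I : Type*} (e₁ e₂ : Fin m ≃ I) :
    ∃ ε : ℝ, ε * ε = 1 ∧ ∀ f : I → Vec m, volForm m (f ∘ e₁) = ε * volForm m (f ∘ e₂) := by
  refine ⟨((Equiv.Perm.sign (e₁.trans e₂.symm) : ℤ) : ℝ), ?_, fun f => ?_⟩
  · rcases Int.units_eq_one_or (Equiv.Perm.sign (e₁.trans e₂.symm)) with h | h <;> simp [h]
  · have := (volForm m).map_perm (f ∘ e₂) (e₁.trans e₂.symm)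
    have h2 : (f ∘ e₂) ∘ (e₁.trans e₂.symm) = f ∘ e₁ := by ext; simp
    rw [h2] at this
    rw [this, Units.smul_def, zsmul_eq_mul]

/-- The volume form evaluated on the concatenation of two tuples of vectors. -/
def volPair {m p l : ℕ} (h : p + l = m) (v : Fin p → Vec m) (w : Fin l → Vec m) : ℝ :=
  volForm m (Fin.append v w ∘ Fin.cast h.symm)

/-- The volume form, with the first arguments fixed, as an alternating map of the remaining ones. -/
def volRight {m p l : ℕ} (h : p + l = m) (v : Fin p → Vec m) : (Vec m) [⋀^Fin l]→ₗ[ℝ] ℝ :=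
  contrMany p v ((volForm m).domDomCongr (finCongr h.symm))

lemma volRight_apply {m p l : ℕ} (h : p + l = m) (v : Fin p → Vec m) (w : Fin l → Vec m) :
    volRight h v w = volPair h v w := by
  rw [volRight, contrMany_apply, AlternatingMap.domDomCongr_apply]; rfl

lemma exists_sign_volPair_swap {m p l : ℕ} (h : p + l = m) (h' : l + p = m) :
    ∃ ε : ℝ, ε * ε = 1 ∧ ∀ (v : Fin p → Vec m) (w : Fin l → Vec m),
      volPair h v w = ε * volPair h' w v := by
  obtain ⟨ε, h1, h2⟩ := exists_sign_volForm
    ((finCongr h.symm).trans finSumFinEquiv.symm)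
    (((finCongr h'.symm).trans finSumFinEquiv.symm).trans (Equiv.sumComm _ _))
  refine ⟨ε, h1, fun v w => ?_⟩
  have := h2 (Sum.elim v w)
  convert this using 2
  · rw [volPair, append_eq_sumElim]; rfl
  · rw [volPair, append_eq_sumElim]; congr 1; funext i
    simp only [Function.comp, Equiv.trans_apply, finCongr_apply]
    generalize finSumFinEquiv.symm (Fin.cast h'.symm i) = z
    cases z <;> rfl

lemma starAlt_apply {m k : ℕ} (h : k + (m - k) = m) (α : (Vec m) [⋀^Fin k]→ₗ[ℝ] ℝ)
    (w : Fin (m - k) → Vec m) :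
    starAlt m k α w = (k.factorial : ℝ)⁻¹ * ∑ g : Fin k → Fin m, α (frame g) * volPair h (frame g) w := by
  have hk : k ≤ m := by omega
  simp only [starAlt, dif_pos hk, AlternatingMap.smul_apply, smul_eq_mul]
  rw [alternatingMap_sum_apply]
  simp only [← volRight_apply]
  rfl

lemma volPair_comp_perm {m p l : ℕ} (h : p + l = m) (v : Fin p → Vec m) (w : Fin l → Vec m)
    (σ : Equiv.Perm (Fin p)) :
    volPair h (v ∘ σ) w = ((Equiv.Perm.sign σ : ℤ) : ℝ) * volPair h v w := by
  obtain ⟨ε, -, hε⟩ := exists_sign_volPair_swap h (by omega : l + p = m)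
  rw [hε, hε, ← volRight_apply, ← volRight_apply, AlternatingMap.map_perm, Units.smul_def,
    zsmul_eq_mul, mul_left_comm]

lemma factorial_mul_wedgeAlt_nuForm {m l : ℕ} (u : Vec m) (γ : (Vec m) [⋀^Fin l]→ₗ[ℝ] ℝ)
    (v : Fin (1 + l) → Vec m) :
    (l.factorial : ℝ) * wedgeAlt (nuForm m u) γ v =
      ∑ σ : Equiv.Perm (Fin 1 ⊕ Fin l), ((Equiv.Perm.sign σ : ℤ) : ℝ) *
        (dotLin m u (v (finSumFinEquiv (σ (Sum.inl 0)))) *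
          γ (fun j => v (finSumFinEquiv (σ (Sum.inr j))))) := by
  have key := MultilinearMap.domCoprod_alternization_eq (nuForm m u) γ
  have key2 := congrArg (fun T : (Vec m) [⋀^Fin 1 ⊕ Fin l]→ₗ[ℝ] (TensorProduct ℝ ℝ ℝ) =>
    TensorProduct.lid ℝ ℝ (T (v ∘ finSumFinEquiv))) key
  simp only [MultilinearMap.alternatization_apply, AlternatingMap.smul_apply, map_sum,
    map_nsmul, Fintype.card_fin, Nat.factorial_one, one_mul] at key2
  rw [nsmul_eq_mul] at key2
  have e : wedgeAlt (nuForm m u) γ v =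
    TensorProduct.lid ℝ ℝ ((nuForm m u).domCoprod γ (v ∘ finSumFinEquiv)) := rfl
  rw [e, ← key2]
  refine Finset.sum_congr rfl fun σ _ => ?_
  rw [Units.smul_def, map_zsmul, zsmul_eq_mul]
  simp only [MultilinearMap.domDomCongr_apply, MultilinearMap.domCoprod_apply,
    TensorProduct.lid_tmul, smul_eq_mul]
  rfl

lemma starAlt_wedge_nuForm {m l : ℕ} (h : (1 + l) + (m - (1 + l)) = m) (u : Vec m)
    (γ : (Vec m) [⋀^Fin l]→ₗ[ℝ] ℝ) (w : Fin (m - (1 + l)) → Vec m) :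
    starAlt m (1 + l) (wedgeAlt (nuForm m u) γ) w =
      (l.factorial : ℝ)⁻¹ * ∑ g : Fin l → Fin m, γ (frame g) *
        volPair h (Fin.append (fun _ : Fin 1 => u) (frame g)) w := by
  rw [starAlt_apply h]
  have hl : (l.factorial : ℝ) ≠ 0 := by positivity
  have hl1 : ((1 + l).factorial : ℝ) ≠ 0 := by positivity
  rw [inv_mul_eq_iff_eq_mul₀ hl1, ← mul_right_inj' hl, Finset.mul_sum]
  conv_lhs =>
    enter [2, g]
    rw [← mul_assoc, factorial_mul_wedgeAlt_nuForm]
  have hre : ∀ F : (Fin (1 + l) → Fin m) → ℝ, ∑ g, F g =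
      ∑ G : Fin 1 ⊕ Fin l → Fin m, F (G ∘ finSumFinEquiv.symm) := fun F =>
    (Equiv.sum_comp (Equiv.arrowCongr finSumFinEquiv (Equiv.refl (Fin m))) F).symm
  rw [hre]
  simp only [Finset.sum_mul]
  rw [Finset.sum_comm]
  have hσ : ∀ σ : Equiv.Perm (Fin 1 ⊕ Fin l),
      (∑ G : Fin 1 ⊕ Fin l → Fin m, ((Equiv.Perm.sign σ : ℤ) : ℝ) *
        (dotLin m u (frame (G ∘ finSumFinEquiv.symm) (finSumFinEquiv (σ (Sum.inl 0)))) *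
          γ (fun j => frame (G ∘ finSumFinEquiv.symm) (finSumFinEquiv (σ (Sum.inr j))))) *
        volPair h (frame (G ∘ finSumFinEquiv.symm)) w) =
      ∑ G : Fin 1 ⊕ Fin l → Fin m, dotLin m u (frame G (Sum.inl 0)) *
          γ (fun j => frame G (Sum.inr j)) * volPair h (frame (G ∘ finSumFinEquiv.symm)) w := by
    intro σ
    rw [← Equiv.sum_comp (Equiv.arrowCongr σ (Equiv.refl (Fin m)))]
    refine Finset.sum_congr rfl fun G _ => ?_
    have h1 : frame ((Equiv.arrowCongr σ (Equiv.refl (Fin m)) G) ∘ finSumFinEquiv.symm) =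
        frame (m := m) (G ∘ finSumFinEquiv.symm) ∘
          ((finSumFinEquiv.symm.trans σ.symm).trans finSumFinEquiv) := by
      funext i; simp [frame, Equiv.arrowCongr]
    rw [h1, volPair_comp_perm]
    have h2 : Equiv.Perm.sign ((finSumFinEquiv.symm.trans σ.symm).trans finSumFinEquiv) =
        Equiv.Perm.sign σ := by
      refine (Equiv.Perm.sign_symm_trans_trans σ.symm finSumFinEquiv).trans ?_; exact Equiv.Perm.sign_inv σ
    rw [h2]
    have h3 : (((Equiv.Perm.sign σ : ℤ) : ℝ)) * ((Equiv.Perm.sign σ : ℤ) : ℝ) = 1 := by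
      rcases Int.units_eq_one_or (Equiv.Perm.sign σ) with h | h <;> simp [h]
    simp only [frame, Function.comp, Equiv.trans_apply, Equiv.symm_apply_apply]
    linear_combination (dotLin m u (frame G (Sum.inl 0)) *
          γ (fun j => frame G (Sum.inr j)) *
            volPair h (frame (G ∘ finSumFinEquiv.symm)) w) * h3
  rw [Finset.sum_congr rfl fun σ _ => hσ σ, Finset.sum_const, nsmul_eq_mul, Finset.card_univ,
    Fintype.card_perm, Fintype.card_sum, Fintype.card_fin, Fintype.card_fin]
  rw [mul_left_comm, mul_right_inj' hl1, mul_inv_cancel_left₀ hl]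
  rw [← Equiv.sum_comp (Equiv.sumArrowEquivProdArrow (Fin 1) (Fin l) (Fin m)).symm,
    Fintype.sum_prod_type_right]
  refine Finset.sum_congr rfl fun g _ => ?_
  rw [← Equiv.sum_comp (Equiv.funUnique (Fin 1) (Fin m)).symm]
  obtain ⟨ε, -, hε⟩ := exists_sign_volPair_swap h (by omega : (m - (1 + l)) + (1 + l) = m)
  simp only [hε, ← volRight_apply]
  set T := volRight (by omega : (m - (1 + l)) + (1 + l) = m) w
  have hT : ∀ u : Vec m, T (Fin.append (fun _ : Fin 1 => u) (frame g)) =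
      (T.domDomCongr (finCongr (Nat.add_comm 1 l))).curryLeft u (frame g) := by
    intro u
    rw [AlternatingMap.curryLeft_apply_apply, AlternatingMap.domDomCongr_apply,
      Fin.append_left_eq_cons]
    rfl
  rw [hT]
  conv_rhs => rw [pi_eq_sum_univ' u, map_sum, alternatingMap_sum_apply]
  rw [Finset.mul_sum, Finset.mul_sum]
  refine Finset.sum_congr rfl fun a _ => ?_
  rw [map_smul, AlternatingMap.smul_apply, ← hT]
  have hG : frame (((Equiv.sumArrowEquivProdArrow (Fin 1) (Fin l) (Fin m)).symm
      ((Equiv.funUnique (Fin 1) (Fin m)).symm a, g)) ∘ finSumFinEquiv.symm) =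
      Fin.append (fun _ : Fin 1 => (Pi.single a 1 : Vec m)) (frame g) := by
    funext i
    refine Fin.addCases (fun i => ?_) (fun i => ?_) i <;> simp [frame]
  have hd : dotLin m u (Pi.single a 1) = u a := by
    simp [dotLin, LinearMap.sum_apply, Pi.single_apply]
  rw [hG]
  simp only [frame, Equiv.sumArrowEquivProdArrow_symm_apply_inl,
    Equiv.sumArrowEquivProdArrow_symm_apply_inr, Equiv.funUnique_symm_apply, uniqueElim_const, hd,
    smul_eq_mul]
  ring

lemma map_vecCons_sub_smul {M N : Type*} [AddCommGroup M] [Module ℝ M] [AddCommGroup N]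
    [Module ℝ N] {k : ℕ} (f : M [⋀^Fin (k + 1)]→ₗ[ℝ] N) (u : M) (c : Fin k → ℝ) (w : Fin k → M) :
    f (Matrix.vecCons u fun j => w j - c j • u) = f (Matrix.vecCons u w) := by
  classical
  suffices H : ∀ s : Finset (Fin k),
      f (Matrix.vecCons u fun j => if j ∈ s then w j - c j • u else w j) =
        f (Matrix.vecCons u w) by simpa using H Finset.univ
  intro s
  induction s using Finset.induction_on with
  | empty => simp
  | insert a s ha ih =>
    rw [← ih]
    set p := Matrix.vecCons u fun j => if j ∈ s then w j - c j • u else w j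
    have e : (Matrix.vecCons u fun j => if j ∈ insert a s then w j - c j • u else w j) =
        Function.update p a.succ (p a.succ + (-c a) • p 0) := by
      funext j
      refine Fin.cases ?_ (fun j => ?_) j
      · simp [p, Function.update_of_ne (Fin.succ_ne_zero a).symm]
      · by_cases hj : j = a
        · subst hj; simp [p, ha, sub_eq_add_neg]
        · have : j.succ ≠ a.succ := fun h => hj (Fin.succ_injective _ h)
          simp [p, hj]
    rw [e, f.map_update_add, f.map_update_smul, Function.update_eq_self,
      f.map_update_self _ (Fin.succ_ne_zero a), smul_zero, add_zero]

lemma projSph_apply {m : ℕ} (u v : Vec m) : projSph m u v = v - (dotLin m u v) • u := by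
  simp [projSph]

/-- Up to a global sign, the Hodge star on the sphere is contraction of the ambient Hodge star with
the outward normal. -/
lemma exists_sign_starSph {m l k : ℕ} (h : l + (k + 1) = m) (h' : m - (1 + l) = k) :
    ∃ ε : ℝ, ε * ε = 1 ∧ ∀ (γ : FormOn m (sphereSet m) l) (u : sphereSet m) (w : Fin k → Vec m),
      castFormOn h' (starSph m l γ) u w = ε * ((l.factorial : ℝ)⁻¹ *
        ∑ g : Fin l → Fin m, γ u (frame g) * volPair h (frame g) (Matrix.vecCons u.1 w)) := by
  subst h'
  have h1 : (1 + l) + (m - (1 + l)) = m := by omega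
  obtain ⟨ε, hε, H⟩ := exists_sign_volForm
    ((finCongr h1.symm).trans (finSumFinEquiv.symm.trans
      (Equiv.sumCongr finSumFinEquiv.symm (Equiv.refl (Fin (m - (1 + l)))))))
    ((finCongr h.symm).trans (finSumFinEquiv.symm.trans ((Equiv.sumCongr (Equiv.refl (Fin l))
      ((finCongr (Nat.add_comm _ 1)).trans finSumFinEquiv.symm)).trans
        ((Equiv.sumAssoc _ _ _).symm.trans (Equiv.sumCongr (Equiv.sumComm _ _) (Equiv.refl _))))))
  have hvol : ∀ (x : Vec m) (v : Fin l → Vec m) (w : Fin (m - (1 + l)) → Vec m),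
      volPair h1 (Fin.append (fun _ : Fin 1 => x) v) w = ε * volPair h v (Matrix.vecCons x w) := by
    intro x v w
    have := H (Sum.elim (Sum.elim (fun _ => x) v) w)
    convert this using 2
    · rw [volPair, append_eq_sumElim, append_eq_sumElim]; congr 1; funext i
      simp only [Function.comp, Equiv.trans_apply, finCongr_apply]
      generalize finSumFinEquiv.symm (Fin.cast h1.symm i) = z
      cases z <;> rfl
    · rw [volPair, append_eq_sumElim]; congr 1; funext i
      simp only [Function.comp, Equiv.trans_apply, finCongr_apply]
      generalize finSumFinEquiv.symm (Fin.cast h.symm i) = z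
      rcases z with z | z
      · rfl
      · refine Fin.cases ?_ (fun z => ?_) z
        · have : finSumFinEquiv.symm (Fin.cast (Nat.add_comm _ 1) (0 : Fin (m - (1 + l) + 1))) =
            Sum.inl (0 : Fin 1) := by rw [Equiv.symm_apply_eq]; rfl
          change x = Sum.elim (Sum.elim (fun _ => x) v) w (Sum.map Sum.swap id
            ((Equiv.sumAssoc _ _ _).symm (Sum.inr (finSumFinEquiv.symm
              (Fin.cast (Nat.add_comm _ 1) (0 : Fin (m - (1 + l) + 1)))))))
          rw [this]; rfl
        · have : finSumFinEquiv.symm (Fin.cast (Nat.add_comm _ 1) z.succ) =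
            (Sum.inr z : Fin 1 ⊕ Fin _) := by
              rw [Equiv.symm_apply_eq]; ext; simp; omega
          simp [this]
  refine ⟨ε, hε, fun γ u w => ?_⟩
  have h2 : castFormOn rfl (starSph m l γ) u w =
      starAlt m (1 + l) (wedgeAlt (nuForm m u.1) (γ u)) (fun i => projSph m u.1 (w i)) := rfl
  rw [h2, starAlt_wedge_nuForm h1, mul_left_comm ε]
  congr 1
  rw [Finset.mul_sum]
  refine Finset.sum_congr rfl fun g _ => ?_
  rw [hvol, mul_left_comm]
  simp only [projSph_apply]
  rw [← volRight_apply, map_vecCons_sub_smul, volRight_apply]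

lemma volPair_frame_eq_zero {m p l : ℕ} (h : p + l = m) {f : Fin p → Fin m} {g : Fin l → Fin m}
    (hfg : ¬ Function.Injective (Fin.append f g)) : volPair h (frame f) (frame g) = 0 := by
  have e : Fin.append (frame f) (frame g) = frame (m := m) (Fin.append f g) := by
    funext i
    refine Fin.addCases (fun i => ?_) (fun i => ?_) i <;> simp [frame]
  rw [volPair, e]
  simp only [Function.Injective, not_forall] at hfg
  obtain ⟨a, b, hab, hne⟩ := hfg
  refine (volForm m).map_eq_zero_of_eq (i := Fin.cast h a) (j := Fin.cast h b) _ ?_ ?_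
  · simp [frame, hab]
  · simpa using hne

lemma volPair_frame_sq {m p l : ℕ} (h : p + l = m) {f : Fin p → Fin m} {g : Fin l → Fin m}
    (hfg : Function.Injective (Fin.append f g)) :
    volPair h (frame f) (frame g) * volPair h (frame f) (frame g) = 1 := by
  subst h
  have e : Fin.append (frame f) (frame g) = frame (m := p + l) (Fin.append f g) := by
    funext i
    refine Fin.addCases (fun i => ?_) (fun i => ?_) i <;> simp [frame]
  have hb : Function.Bijective (Fin.append f g) := Finite.injective_iff_bijective.mp hfg
  let σ : Equiv.Perm (Fin (p + l)) := Equiv.ofBijective _ hb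
  have e2 : volPair rfl (frame f) (frame g) = ((Equiv.Perm.sign σ : ℤ) : ℝ) := by
    have : volPair rfl (frame f) (frame g) =
      volForm (p + l) ((Pi.basisFun ℝ (Fin (p + l))) ∘ σ) := by
        rw [volPair, e]; congr 1; funext i; simp [frame, σ]
    rw [this, AlternatingMap.map_perm, volForm, Module.Basis.det_self]
    simp [Units.smul_def]
  rw [e2]
  rcases Int.units_eq_one_or (Equiv.Perm.sign σ) with h | h <;> simp [h]

lemma sum_eq_factorial_mul_of_perm_invariant {m p : ℕ} (F : (Fin p → Fin m) → ℝ)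
    {f : Fin p → Fin m} (hf : Function.Injective f)
    (h0 : ∀ g, F g ≠ 0 → Function.Injective g ∧ Set.range g ⊆ Set.range f)
    (h1 : ∀ σ : Equiv.Perm (Fin p), F (f ∘ σ) = F f) :
    ∑ g, F g = p.factorial * F f := by
  classical
  have hinj : Function.Injective fun σ : Equiv.Perm (Fin p) => f ∘ σ := by
    intro σ τ hst
    ext i
    exact congrArg Fin.val (hf (congrFun hst i))
  have : ∑ g, F g = ∑ g ∈ Finset.univ.image fun σ : Equiv.Perm (Fin p) => f ∘ σ, F g := by
    refine (Finset.sum_subset (Finset.subset_univ _) fun g _ hg => ?_).symm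
    by_contra hne
    obtain ⟨hgi, hr⟩ := h0 g hne
    choose τ hτ using fun i => hr ⟨i, rfl⟩
    have hτi : Function.Injective τ := fun a b hab => hgi (by rw [← hτ, ← hτ, hab])
    refine hg (Finset.mem_image.mpr ⟨Equiv.ofBijective τ
      (Finite.injective_iff_bijective.mp hτi), Finset.mem_univ _, funext hτ⟩)
  rw [this, Finset.sum_image fun a _ b _ hab => hinj hab, Finset.sum_congr rfl fun σ _ => h1 σ]
  simp [Fintype.card_perm]

lemma injective_append_iff {p l : ℕ} {β : Type*} {f : Fin p → β} {c : Fin l → β} :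
    Function.Injective (Fin.append f c) ↔
      Function.Injective f ∧ Function.Injective c ∧ ∀ i j, f i ≠ c j := by
  rw [append_eq_sumElim, Equiv.injective_comp]
  refine ⟨fun h => ⟨fun a b hab => ?_, fun a b hab => ?_, fun a b hab => ?_⟩,
    fun h => Function.Injective.sumElim h.1 h.2.1 h.2.2⟩
  · simpa using @h (Sum.inl a) (Sum.inl b) hab
  · simpa using @h (Sum.inr a) (Sum.inr b) hab
  · simpa using @h (Sum.inl a) (Sum.inr b) hab

lemma range_subset_range_of_append_injective {m p l : ℕ} (h : p + l = m) {f g : Fin p → Fin m}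
    {c : Fin l → Fin m} (hf : Function.Injective (Fin.append f c))
    (hg : Function.Injective (Fin.append g c)) : Set.range g ⊆ Set.range f := by
  subst h
  rintro _ ⟨i, rfl⟩
  obtain ⟨j, hj⟩ := (Finite.injective_iff_surjective.mp hf) (g i)
  revert hj
  refine Fin.addCases (fun j => ?_) (fun j => ?_) j
  · intro hj; exact ⟨j, by simpa using hj⟩
  · intro hj
    have := @hg (Fin.castAdd l i) (Fin.natAdd p j) (by simpa using hj.symm)
    have := congrArg Fin.val this
    simp at this; omega

lemma sum_volPair_mul {m p l : ℕ} (h : p + l = m) (ζ : (Vec m) [⋀^Fin p]→ₗ[ℝ] ℝ)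
    {f : Fin p → Fin m} {c : Fin l → Fin m} (hfc : Function.Injective (Fin.append f c)) :
    ∑ g : Fin p → Fin m, ζ (frame g) * volPair h (frame g) (frame c) =
      p.factorial * (ζ (frame f) * volPair h (frame f) (frame c)) := by
  refine sum_eq_factorial_mul_of_perm_invariant
    (fun g => ζ (frame g) * volPair h (frame g) (frame c)) ?_ (fun g hg => ?_) fun σ => ?_
  · exact (injective_append_iff.mp hfc).1
  · have hgc : Function.Injective (Fin.append g c) := by
      by_contra hn; exact hg (by simp [volPair_frame_eq_zero h hn])
    exact ⟨(injective_append_iff.mp hgc).1, range_subset_range_of_append_injective h hfc hgc⟩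
  · have e : frame (m := m) (f ∘ σ) = frame f ∘ σ := rfl
    have h3 : (((Equiv.Perm.sign σ : ℤ) : ℝ)) * ((Equiv.Perm.sign σ : ℤ) : ℝ) = 1 := by
      rcases Int.units_eq_one_or (Equiv.Perm.sign σ) with h | h <;> simp [h]
    simp only [e, volPair_comp_perm, AlternatingMap.map_perm, Units.smul_def, zsmul_eq_mul]
    linear_combination (ζ (frame f) * volPair h (frame f) (frame c)) * h3

/-- The Hodge star of a tensor, twice, is the identity up to a global sign. -/
lemma exists_sign_star_star {m p l : ℕ} (h : p + l = m) (h' : l + p = m) :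
    ∃ ε : ℝ, ε * ε = 1 ∧ ∀ (ζ : (Vec m) [⋀^Fin p]→ₗ[ℝ] ℝ) (v : Fin p → Vec m),
      (l.factorial : ℝ)⁻¹ * ∑ c : Fin l → Fin m, ((p.factorial : ℝ)⁻¹ *
        ∑ g : Fin p → Fin m, ζ (frame g) * volPair h (frame g) (frame c)) *
          volPair h' (frame c) v = ε * ζ v := by
  obtain ⟨ε, hε, H⟩ := exists_sign_volPair_swap h' h
  refine ⟨ε, hε, fun ζ v => ?_⟩
  have hp : (p.factorial : ℝ) ≠ 0 := by positivity
  have hl : (l.factorial : ℝ) ≠ 0 := by positivity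
  let S : (Vec m) [⋀^Fin p]→ₗ[ℝ] ℝ := (l.factorial : ℝ)⁻¹ • ∑ c : Fin l → Fin m,
    ((p.factorial : ℝ)⁻¹ * ∑ g : Fin p → Fin m, ζ (frame g) * volPair h (frame g) (frame c)) •
      volRight h' (frame c)
  have hS : ∀ v, S v = (l.factorial : ℝ)⁻¹ * ∑ c : Fin l → Fin m, ((p.factorial : ℝ)⁻¹ *
        ∑ g : Fin p → Fin m, ζ (frame g) * volPair h (frame g) (frame c)) *
          volPair h' (frame c) v := by
    intro v
    simp only [S, AlternatingMap.smul_apply, alternatingMap_sum_apply, smul_eq_mul, volRight_apply]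
  rw [← hS]
  suffices S = ε • ζ by rw [this]; rfl
  refine Module.Basis.ext_alternating (Pi.basisFun ℝ (Fin m)) fun f hf => ?_
  have hfr : (fun i => Pi.basisFun ℝ (Fin m) (f i)) = frame f := by funext i; simp [frame]
  rw [hfr, hS, AlternatingMap.smul_apply, smul_eq_mul]
  obtain ⟨c₀, hc₀⟩ : ∃ c : Fin l → Fin m, Function.Injective (Fin.append f c) := by
    have hcard : (Set.range f)ᶜ.ncard = l := by
      rw [Set.ncard_compl, Set.ncard_range_of_injective hf]
      simp; omega
    have hfin : Nat.card ((Set.range f)ᶜ : Set (Fin m)) = l := hcard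
    let e := (Finite.equivFinOfCardEq hfin).symm
    refine ⟨fun i => (e i).1, ?_⟩
    refine injective_append_iff.mpr ⟨hf, Subtype.val_injective.comp e.injective, ?_⟩
    intro a b hab
    exact (e b).2 ⟨a, hab⟩
  have hterm : ∀ c : Fin l → Fin m, ((p.factorial : ℝ)⁻¹ *
        ∑ g : Fin p → Fin m, ζ (frame g) * volPair h (frame g) (frame c)) *
          volPair h' (frame c) (frame f) =
        ε * ζ (frame f) * (volPair h (frame f) (frame c) * volPair h (frame f) (frame c)) := by
    intro c
    rw [H]
    by_cases hfc : Function.Injective (Fin.append f c)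
    · rw [sum_volPair_mul h ζ hfc, inv_mul_cancel_left₀ hp]; ring
    · rw [volPair_frame_eq_zero h hfc]; ring
  rw [Finset.sum_congr rfl fun c _ => hterm c, ← Finset.mul_sum]
  have := sum_eq_factorial_mul_of_perm_invariant
    (fun c => volPair h (frame f) (frame c) * volPair h (frame f) (frame c)) (f := c₀) ?_ ?_ ?_
  · simp only [this, volPair_frame_sq h hc₀, mul_one]
    field_simp
  · exact (injective_append_iff.mp hc₀).2.1
  · intro c hc
    have hfc : Function.Injective (Fin.append f c) := by
      by_contra hn; exact hc (by simp [volPair_frame_eq_zero h hn])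
    rw [injective_append_iff] at hfc hc₀
    refine ⟨hfc.2.1, range_subset_range_of_append_injective h' (c := f) ?_ ?_⟩
    · exact injective_append_iff.mpr ⟨hc₀.2.1, hc₀.1, fun i j => (hc₀.2.2 j i).symm⟩
    · exact injective_append_iff.mpr ⟨hfc.2.1, hfc.1, fun i j => (hfc.2.2 j i).symm⟩
  · intro σ
    have hσ : Function.Injective (Fin.append f (c₀ ∘ σ)) := by
      rw [injective_append_iff] at hc₀ ⊢
      exact ⟨hc₀.1, hc₀.2.1.comp σ.injective, fun i j => hc₀.2.2 i (σ j)⟩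
    rw [volPair_frame_sq h hσ, volPair_frame_sq h hc₀]

/-- Alternating tensors with polynomial values, i.e. forms with polynomial coefficients. -/
abbrev PForm (m k : ℕ) := Vec m [⋀^Fin k]→ₗ[ℝ] MvPolynomial (Fin m) ℝ

/-- Evaluation of polynomials at a point, as a linear map. -/
def evalLin {m : ℕ} (x : Vec m) : MvPolynomial (Fin m) ℝ →ₗ[ℝ] ℝ :=
  (MvPolynomial.aeval x).toLinearMap

lemma evalLin_apply {m : ℕ} (x : Vec m) (p : MvPolynomial (Fin m) ℝ) :
    evalLin x p = MvPolynomial.eval x p := by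
  simp [evalLin, MvPolynomial.aeval_eq_eval]

/-- The form with the given polynomial coefficients. -/
def toForm {m k : ℕ} (F : PForm m k) : Form m k := fun x => (evalLin x).compAlternatingMap F

lemma toForm_apply {m k : ℕ} (F : PForm m k) (x : Vec m) (v : Fin k → Vec m) :
    toForm F x v = MvPolynomial.eval x (F v) := by
  simp [toForm, evalLin_apply]

lemma pform_ext {m k : ℕ} {F G : PForm m k} (h : ∀ x v, toForm F x v = toForm G x v) : F = G := by
  ext1 v
  exact MvPolynomial.funext fun x => by simpa [toForm_apply] using h x v

lemma exists_pform {m k : ℕ} {Q : MvPolynomial (Fin m) ℝ → Prop} {α : Form m k}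
    (h : ∀ v, ∃ p, Q p ∧ ∀ x, α x v = MvPolynomial.eval x p) :
    ∃ F : PForm m k, (∀ v, Q (F v)) ∧ toForm F = α := by
  choose f hf hα using h
  refine ⟨{ toFun := f, map_update_add' := ?_, map_update_smul' := ?_, map_eq_zero_of_eq' := ?_ },
    hf, ?_⟩
  · intro _ v i x y
    refine MvPolynomial.funext fun u => ?_
    rw [map_add, ← hα, ← hα, ← hα, ← (α u).map_update_add]
  · intro _ v i c x
    refine MvPolynomial.funext fun u => ?_
    rw [MvPolynomial.smul_eval, ← hα, ← hα, ← smul_eq_mul, ← (α u).map_update_smul]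
  · intro v i j hv hij
    refine MvPolynomial.funext fun u => ?_
    rw [← hα, map_zero, (α u).map_eq_zero_of_eq v hv hij]
  · funext x
    ext v
    rw [toForm_apply, hα]
    rfl

/-- Polynomials of degree at most `r`. -/
def degSub (m : ℕ) (r : ℤ) : Submodule ℝ (MvPolynomial (Fin m) ℝ) :=
  MvPolynomial.restrictSupport ℝ {d | ((d.degree : ℕ) : ℤ) ≤ r}

lemma mem_degSub {m : ℕ} {r : ℤ} {p : MvPolynomial (Fin m) ℝ} : p ∈ degSub m r ↔ degLE r p := by
  rw [degSub, MvPolynomial.mem_restrictSupport_iff]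
  rfl

lemma toForm_mem_PL {m k : ℕ} {r : ℤ} {F : PForm m k} (h : ∀ v, F v ∈ degSub m r) :
    toForm F ∈ PL m k r :=
  fun v => ⟨F v, mem_degSub.mp (h v), fun x => toForm_apply F x v⟩

lemma exists_toForm_eq {m k : ℕ} {r : ℤ} {α : Form m k} (h : α ∈ PL m k r) :
    ∃ F : PForm m k, (∀ v, F v ∈ degSub m r) ∧ toForm F = α :=
  exists_pform fun v => (h v).imp fun _ hp => ⟨mem_degSub.mpr hp.1, hp.2⟩

lemma map_eq_sum_frame {m k : ℕ} {N : Type*} [AddCommGroup N] [Module ℝ N]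
    (f : Vec m [⋀^Fin k]→ₗ[ℝ] N) (v : Fin k → Vec m) :
    f v = ∑ g : Fin k → Fin m, (∏ j, v j (g j)) • f (frame g) := by
  have h : v = fun j => ∑ a : Fin m, v j a • (Pi.single a 1 : Vec m) :=
    funext fun j => pi_eq_sum_univ' (v j)
  conv_lhs => rw [h]
  rw [← AlternatingMap.coe_multilinearMap, MultilinearMap.map_sum]
  refine Finset.sum_congr rfl fun g _ => ?_
  rw [MultilinearMap.map_smul_univ]

lemma reflFun_eq_reflLin {m : ℕ} (i : Fin m) (u : Vec m) : reflFun m i u = reflLin m i u := by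
  funext j
  simp only [reflFun, reflLin, LinearMap.pi_apply]
  split <;> simp

/-- The sign by which a reflection acts on a coordinate. -/
def reflSign {m : ℕ} (i j : Fin m) : ℝ := if j = i then -1 else 1

lemma reflSign_mul_self {m : ℕ} (i j : Fin m) : reflSign i j * reflSign i j = 1 := by
  unfold reflSign; split <;> norm_num

lemma reflLin_apply {m : ℕ} (i : Fin m) (v : Vec m) (j : Fin m) :
    reflLin m i v j = reflSign i j * v j := by
  simp only [reflLin, LinearMap.pi_apply, reflSign]
  split <;> simp

lemma reflLin_reflLin {m : ℕ} (i : Fin m) (v : Vec m) : reflLin m i (reflLin m i v) = v := by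
  funext j
  rw [reflLin_apply, reflLin_apply, ← mul_assoc, reflSign_mul_self, one_mul]

lemma reflLin_single {m : ℕ} (i j : Fin m) :
    reflLin m i (Pi.single j 1) = reflSign i j • (Pi.single j 1 : Vec m) := by
  funext a
  rw [reflLin_apply, Pi.smul_apply, smul_eq_mul]
  by_cases h : a = j
  · rw [h]
  · simp [h]

lemma volForm_reflLin {m : ℕ} (i : Fin m) (v : Fin m → Vec m) :
    volForm m (fun j => reflLin m i (v j)) = -volForm m v := by
  have h := (Pi.basisFun ℝ (Fin m)).det_comp (reflLin m i) v
  have hd : reflLin m i = Matrix.toLin' (Matrix.diagonal (reflSign i)) := by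
    refine LinearMap.ext fun a => funext fun b => ?_
    simp [Matrix.mulVec_diagonal, reflLin_apply]
  have hdet : LinearMap.det (reflLin m i) = -1 := by
    rw [hd, LinearMap.det_toLin', Matrix.det_diagonal]
    simp [reflSign, Finset.prod_ite_eq']
  rw [hdet] at h
  simpa [volForm, Function.comp_def] using h

lemma volPair_reflLin {m p l : ℕ} (h : p + l = m) (i : Fin m) (v : Fin p → Vec m)
    (w : Fin l → Vec m) :
    volPair h (fun j => reflLin m i (v j)) (fun j => reflLin m i (w j)) = -volPair h v w := by
  rw [volPair, volPair, ← volForm_reflLin i]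
  congr 1
  funext j
  simp only [Function.comp]
  generalize Fin.cast h.symm j = z
  refine Fin.addCases (fun z => ?_) (fun z => ?_) z <;> simp

/-- The substitution negating the `i`-th variable. -/
def reflAlg {m : ℕ} (i : Fin m) : MvPolynomial (Fin m) ℝ →ₐ[ℝ] MvPolynomial (Fin m) ℝ :=
  MvPolynomial.aeval fun j => reflSign i j • MvPolynomial.X j

lemma eval_reflAlg {m : ℕ} (i : Fin m) (x : Vec m) (p : MvPolynomial (Fin m) ℝ) :
    MvPolynomial.eval x (reflAlg i p) = MvPolynomial.eval (reflLin m i x) p := by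
  have h : (MvPolynomial.aeval x).comp (reflAlg i) =
      (MvPolynomial.aeval (reflLin m i x) : MvPolynomial (Fin m) ℝ →ₐ[ℝ] ℝ) := by
    refine MvPolynomial.algHom_ext fun j => ?_
    simp [reflAlg, reflLin_apply]
  have := DFunLike.congr_fun h p
  simpa [MvPolynomial.aeval_eq_eval] using this

/-- Pullback of a polynomial form along a coordinate reflection. -/
def reflP {m k : ℕ} (i : Fin m) (F : PForm m k) : PForm m k :=
  ((reflAlg i).toLinearMap.compAlternatingMap F).compLinearMap (reflLin m i)

lemma reflP_apply {m k : ℕ} (i : Fin m) (F : PForm m k) (v : Fin k → Vec m) :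
    reflP i F v = reflAlg i (F fun j => reflLin m i (v j)) := rfl

lemma toForm_reflP {m k : ℕ} (i : Fin m) (F : PForm m k) :
    toForm (reflP i F) = reflPull m k i (toForm F) := by
  funext x
  ext v
  rw [toForm_apply, reflP_apply, eval_reflAlg]
  simp only [reflPull, AlternatingMap.compLinearMap_apply, toForm_apply, reflFun_eq_reflLin]

/-- The Hodge star of a polynomial form. -/
def pstar {m p l : ℕ} (h : p + l = m) (F : PForm m p) : PForm m l :=
  (p.factorial : ℝ)⁻¹ • ∑ g : Fin p → Fin m,
    (LinearMap.toSpanSingleton ℝ _ (F (frame g))).compAlternatingMap (volRight h (frame g))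

lemma pstar_apply {m p l : ℕ} (h : p + l = m) (F : PForm m p) (v : Fin l → Vec m) :
    pstar h F v = (p.factorial : ℝ)⁻¹ • ∑ g : Fin p → Fin m,
      volPair h (frame g) v • F (frame g) := by
  simp [pstar, alternatingMap_sum_apply, volRight_apply]

lemma eval_pstar {m p l : ℕ} (h : p + l = m) (F : PForm m p) (x : Vec m) (v : Fin l → Vec m) :
    MvPolynomial.eval x (pstar h F v) = (p.factorial : ℝ)⁻¹ * ∑ g : Fin p → Fin m,
      toForm F x (frame g) * volPair h (frame g) v := by
  simp [pstar_apply, toForm_apply, MvPolynomial.smul_eval, mul_comm]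

lemma pstar_mem_degSub {m p l : ℕ} {r : ℤ} (h : p + l = m) {F : PForm m p}
    (hF : ∀ v, F v ∈ degSub m r) (v : Fin l → Vec m) : pstar h F v ∈ degSub m r := by
  rw [pstar_apply]
  exact Submodule.smul_mem _ _ (Submodule.sum_mem _ fun g _ => Submodule.smul_mem _ _ (hF _))

lemma map_reflLin_frame {m k : ℕ} {N : Type*} [AddCommGroup N] [Module ℝ N]
    (f : Vec m [⋀^Fin k]→ₗ[ℝ] N) (i : Fin m) (g : Fin k → Fin m) :
    f (fun j => reflLin m i (frame g j)) = (∏ j, reflSign i (g j)) • f (frame g) := by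
  simp only [frame, reflLin_single]
  rw [← AlternatingMap.coe_multilinearMap, MultilinearMap.map_smul_univ]

lemma reflP_pstar {m p l : ℕ} (h : p + l = m) (i : Fin m) (F : PForm m p) :
    reflP i (pstar h F) = -pstar h (reflP i F) := by
  ext1 v
  rw [reflP_apply, pstar_apply, AlternatingMap.neg_apply, pstar_apply, map_smul, map_sum,
    ← smul_neg, ← Finset.sum_neg_distrib]
  congr 1
  refine Finset.sum_congr rfl fun g _ => ?_
  rw [reflP_apply, map_reflLin_frame, map_smul, map_smul, ← neg_smul, ← volPair_reflLin h i, smul_smul]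
  congr 1
  obtain ⟨ε, -, hε⟩ := exists_sign_volPair_swap h (by omega : l + p = m)
  rw [hε, hε, ← volRight_apply, ← volRight_apply, map_reflLin_frame, smul_eq_mul]
  have : (∏ j, reflSign i (g j)) * ∏ j, reflSign i (g j) = 1 := by
    rw [← Finset.prod_mul_distrib]; simp [reflSign_mul_self]
  linear_combination (-(ε * volRight (by omega : l + p = m) (fun j => reflLin m i (v j)) (frame g))) * this

lemma pstar_smul {m p l : ℕ} (h : p + l = m) (c : ℝ) (F : PForm m p) :
    pstar h (c • F) = c • pstar h F := by
  ext1 v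
  rw [pstar_apply, AlternatingMap.smul_apply, pstar_apply]
  simp only [AlternatingMap.smul_apply, Finset.smul_sum]
  refine Finset.sum_congr rfl fun g _ => ?_
  rw [smul_comm c, smul_comm c]

lemma exists_sign_pstar_pstar {m p l : ℕ} (h : p + l = m) (h' : l + p = m) :
    ∃ ε : ℝ, ε * ε = 1 ∧ ∀ ζ : PForm m p, pstar h' (pstar h ζ) = ε • ζ := by
  obtain ⟨ε, h1, h2⟩ := exists_sign_star_star h h'
  refine ⟨ε, h1, fun ζ => ?_⟩
  refine pform_ext fun x v => ?_
  have := h2 (toForm ζ x) v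
  rw [toForm_apply, eval_pstar]
  simp only [toForm_apply, eval_pstar, AlternatingMap.smul_apply, MvPolynomial.smul_eval] at this ⊢
  exact this

lemma sum_projSph_eq {m p l : ℕ} (h : p + (l + 1) = m) (T : Vec m [⋀^Fin p]→ₗ[ℝ] ℝ) (u : Vec m)
    (w : Fin l → Vec m) :
    ∑ g : Fin p → Fin m, T.compLinearMap (projSph m u) (frame g) *
      volPair h (frame g) (Matrix.vecCons u w) =
    ∑ g : Fin p → Fin m, T (frame g) * volPair h (frame g) (Matrix.vecCons u w) := by
  obtain ⟨ε, -, hε⟩ := exists_sign_volPair_swap h (by omega : (l + 1) + p = m)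
  simp only [hε, ← volRight_apply]
  set V := volRight (by omega : (l + 1) + p = m) (Matrix.vecCons u w)
  have hV : V.compLinearMap (projSph m u) = V := by
    ext1 v
    rw [AlternatingMap.compLinearMap_apply]
    have key : ∀ (c : Fin p → ℝ) (v : Fin p → Vec m), V (fun j => v j - c j • u) = V v := by
      intro c v
      suffices H : ∀ s : Finset (Fin p), V (fun j => if j ∈ s then v j - c j • u else v j) = V v by
        simpa using H Finset.univ
      intro s
      induction s using Finset.induction_on with
      | empty => simp
      | insert a s ha ih =>
        rw [← ih]
        have e : (fun j => if j ∈ insert a s then v j - c j • u else v j) =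
            Function.update (fun j => if j ∈ s then v j - c j • u else v j) a
              (v a + (-c a) • u) := by
          funext j
          by_cases hj : j = a
          · subst hj; simp [sub_eq_add_neg]
          · simp [hj]
        have e' : (fun j => if j ∈ s then v j - c j • u else v j) =
          Function.update (fun j => if j ∈ s then v j - c j • u else v j) a (v a) := by
            rw [eq_comm, Function.update_eq_self_iff]; simp [ha]
        rw [e, V.map_update_add, V.map_update_smul, ← e']
        have hz : V (Function.update (fun j => if j ∈ s then v j - c j • u else v j) a u) = 0 := by
          rw [volRight_apply, volPair]
          refine (volForm m).map_eq_zero_of_eq _ (i := ⟨0, by omega⟩)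
            (j := ⟨l + 1 + a, by omega⟩) ?_ (by simp [Fin.ext_iff]; omega)
          simp [append_apply, show ¬ l + 1 + (a : ℕ) ≤ l by omega]
        rw [hz, smul_zero, add_zero]
    simp only [projSph_apply]
    exact key _ v
  have hP : ∀ a b, projSph m u (Pi.single a 1) b = projSph m u (Pi.single b 1) a := by
    intro a b
    have hd : ∀ a, dotLin m u (Pi.single a 1) = u a := by
      intro a; simp [dotLin, LinearMap.sum_apply, Pi.single_apply]
    simp only [projSph_apply, hd, Pi.sub_apply, Pi.smul_apply, smul_eq_mul, Pi.single_apply,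
      mul_comm (u a), eq_comm (a := a)]
  conv_rhs => rw [← hV]
  simp only [AlternatingMap.compLinearMap_apply]
  have e1 : ∀ g : Fin p → Fin m, T (fun i => projSph m u (frame g i)) =
    ∑ f : Fin p → Fin m, (∏ j, projSph m u (frame g j) (f j)) * T (frame f) :=
      fun g => map_eq_sum_frame T _
  have e2 : ∀ g : Fin p → Fin m, V (fun i => projSph m u (frame g i)) =
    ∑ f : Fin p → Fin m, (∏ j, projSph m u (frame g j) (f j)) * V (frame f) :=
      fun g => map_eq_sum_frame V _
  simp only [e1, e2, Finset.sum_mul, Finset.mul_sum]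
  rw [Finset.sum_comm]
  refine Finset.sum_congr rfl fun f _ => Finset.sum_congr rfl fun g _ => ?_
  simp only [frame]
  rw [Finset.prod_congr rfl fun j _ => hP (g j) (f j)]
  ring

/-- The Hodge star on the sphere of the restriction of a polynomial form is, up to a global sign,
the ambient Hodge star contracted with the radial field. -/
lemma exists_sign_starSph_resSph {m l k : ℕ} (h : l + (k + 1) = m) (h' : m - (1 + l) = k) :
    ∃ ε : ℝ, ε * ε = 1 ∧ ∀ (G : PForm m l) (u : sphereSet m) (w : Fin k → Vec m),
      castFormOn h' (starSph m l (resSph m l (toForm G))) u w =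
        ε * MvPolynomial.eval u.1 (pstar h G (Matrix.vecCons u.1 w)) := by
  obtain ⟨ε, h1, h2⟩ := exists_sign_starSph h h'
  refine ⟨ε, h1, fun G u w => ?_⟩
  rw [h2, eval_pstar, ← sum_projSph_eq h (toForm G u.1)]
  rfl

lemma reflAlg_monomial {m : ℕ} (i : Fin m) (d : Fin m →₀ ℕ) (c : ℝ) :
    reflAlg i (MvPolynomial.monomial d c) = MvPolynomial.monomial d ((-1) ^ d i * c) := by
  rw [reflAlg, MvPolynomial.aeval_monomial, Finsupp.prod_fintype _ _ (by simp)]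
  simp only [Algebra.smul_def, mul_pow, ← map_pow, MvPolynomial.algebraMap_eq]
  rw [Finset.prod_mul_distrib, ← map_prod]
  have h1 : ∏ j, reflSign i j ^ d j = (-1) ^ d i := by
    simp [reflSign, ite_pow, Finset.prod_ite_eq']
  rw [h1, MvPolynomial.monomial_eq, Finsupp.prod_fintype _ _ (by simp), ← mul_assoc, ← map_mul,
    mul_comm c]

lemma coeff_reflAlg {m : ℕ} (i : Fin m) (p : MvPolynomial (Fin m) ℝ) (d : Fin m →₀ ℕ) :
    (reflAlg i p).coeff d = (-1) ^ d i * p.coeff d := by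
  induction p using MvPolynomial.induction_on' with
  | monomial e c =>
    rw [reflAlg_monomial, MvPolynomial.coeff_monomial, MvPolynomial.coeff_monomial]
    split_ifs with h
    · rw [h]
    · simp
  | add p q hp hq => rw [map_add, MvPolynomial.coeff_add, hp, hq, MvPolynomial.coeff_add, mul_add]

lemma mem_degSub_iff_coeff {m : ℕ} {r : ℤ} {p : MvPolynomial (Fin m) ℝ} :
    p ∈ degSub m r ↔ ∀ d, p.coeff d ≠ 0 → (d.degree : ℤ) ≤ r := by
  rw [degSub, MvPolynomial.mem_restrictSupport_iff]
  simp [Set.subset_def]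

lemma reflAlg_mem_degSub {m : ℕ} {r : ℤ} (i : Fin m) {p : MvPolynomial (Fin m) ℝ}
    (h : p ∈ degSub m r) : reflAlg i p ∈ degSub m r := by
  rw [mem_degSub_iff_coeff] at h ⊢
  intro d hd
  rw [coeff_reflAlg] at hd
  exact h d (right_ne_zero_of_mul hd)

lemma reflAlg_reflAlg {m : ℕ} (i : Fin m) (p : MvPolynomial (Fin m) ℝ) :
    reflAlg i (reflAlg i p) = p := by
  ext d
  rw [coeff_reflAlg, coeff_reflAlg, ← mul_assoc, ← mul_pow]
  simp

lemma reflAlg_comm {m : ℕ} (i j : Fin m) (p : MvPolynomial (Fin m) ℝ) :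
    reflAlg i (reflAlg j p) = reflAlg j (reflAlg i p) := by
  ext d
  rw [coeff_reflAlg, coeff_reflAlg, coeff_reflAlg, coeff_reflAlg, mul_left_comm]

lemma reflP_reflP {m k : ℕ} (i : Fin m) (F : PForm m k) : reflP i (reflP i F) = F := by
  ext1 v
  simp only [reflP_apply, reflAlg_reflAlg, reflLin_reflLin]

lemma reflLin_comm {m : ℕ} (i j : Fin m) (v : Vec m) :
    reflLin m i (reflLin m j v) = reflLin m j (reflLin m i v) := by
  funext a
  simp only [reflLin_apply, mul_left_comm]

lemma reflP_comm {m k : ℕ} (i j : Fin m) (F : PForm m k) :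
    reflP i (reflP j F) = reflP j (reflP i F) := by
  ext1 v
  simp only [reflP_apply, reflLin_comm j i, reflAlg_comm j i]

lemma reflP_add {m k : ℕ} (i : Fin m) (F G : PForm m k) :
    reflP i (F + G) = reflP i F + reflP i G := by
  ext1 v
  simp [reflP_apply]

lemma reflP_smul {m k : ℕ} (i : Fin m) (c : ℝ) (F : PForm m k) :
    reflP i (c • F) = c • reflP i F := by
  ext1 v
  simp only [reflP_apply, AlternatingMap.smul_apply, map_smul]

lemma projSph_reflLin {m : ℕ} (i : Fin m) (u v : Vec m) :
    projSph m (reflLin m i u) (reflLin m i v) = reflLin m i (projSph m u v) := by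
  have h : dotLin m (reflLin m i u) (reflLin m i v) = dotLin m u v := by
    simp only [dotLin, LinearMap.sum_apply, LinearMap.smul_apply, LinearMap.proj_apply,
      smul_eq_mul, reflLin_apply]
    refine Finset.sum_congr rfl fun j _ => ?_
    linear_combination (u j * v j) * reflSign_mul_self i j
  rw [projSph_apply, projSph_apply, h, map_sub, map_smul]

lemma resSph_toForm_reflP {m k : ℕ} (i : Fin m) (F : PForm m k) :
    resSph m k (toForm (reflP i F)) = reflPullSph m k i (resSph m k (toForm F)) := by
  funext u
  ext v
  rw [toForm_reflP]
  simp only [resSph, reflPullSph, reflPull, AlternatingMap.compLinearMap_apply]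
  simp only [reflFun_eq_reflLin, projSph_reflLin]

lemma exists_even_extension {m k : ℕ} {r : ℤ} {G : PForm m k} (hG : ∀ v, G v ∈ degSub m r)
    (he : IsEvenSph m k (resSph m k (toForm G))) :
    ∃ G' : PForm m k, (∀ v, G' v ∈ degSub m r) ∧ (∀ i, reflP i G' = G') ∧
      resSph m k (toForm G') = resSph m k (toForm G) := by
  suffices H : ∀ s : Finset (Fin m), ∃ G' : PForm m k, (∀ v, G' v ∈ degSub m r) ∧
      (∀ i ∈ s, reflP i G' = G') ∧ resSph m k (toForm G') = resSph m k (toForm G) by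
    simpa using H Finset.univ
  intro s
  induction s using Finset.induction_on with
  | empty => exact ⟨G, hG, by simp, rfl⟩
  | insert a s ha ih =>
    obtain ⟨G', h1, h2, h3⟩ := ih
    refine ⟨(2 : ℝ)⁻¹ • (G' + reflP a G'), fun v => ?_, fun i hi => ?_, ?_⟩
    · exact Submodule.smul_mem _ _ (Submodule.add_mem _ (h1 v) (reflAlg_mem_degSub a (h1 _)))
    · rw [reflP_smul, reflP_add]
      rcases Finset.mem_insert.mp hi with rfl | hi
      · rw [reflP_reflP, add_comm]
      · rw [reflP_comm, h2 i hi]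
    · have hr := resSph_toForm_reflP a G'
      rw [h3, he a] at hr
      funext u
      ext v
      have e1 := congrArg (fun T => T v) (congrFun h3 u)
      have e2 := congrArg (fun T => T v) (congrFun hr u)
      simp only [resSph, AlternatingMap.compLinearMap_apply, toForm_apply,
        AlternatingMap.smul_apply, AlternatingMap.add_apply, MvPolynomial.smul_eval, map_add] at e1 e2 ⊢
      rw [e1, e2]
      ring

/-- Odd polynomial forms, contracted with the radial field, are exactly the Hodge stars on the
sphere of even polynomial forms of the complementary degree. -/
lemma exists_odd_of_even {m l k : ℕ} {r : ℤ} (h : l + (k + 1) = m) (h' : m - (1 + l) = k)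
    {γ : FormOn m (sphereSet m) l} (hγ : γ ∈ PLsph m l r) (he : IsEvenSph m l γ) :
    ∃ ζ : PForm m (k + 1), (∀ v, ζ v ∈ degSub m r) ∧ (∀ i, reflP i ζ = -ζ) ∧
      ∀ (u : sphereSet m) w, castFormOn h' (starSph m l γ) u w =
        MvPolynomial.eval u.1 (ζ (Matrix.vecCons u.1 w)) := by
  obtain ⟨_, hα, rfl⟩ := hγ
  obtain ⟨G, hG, rfl⟩ := exists_toForm_eq hα
  obtain ⟨G', h1, h2, h3⟩ := exists_even_extension hG he
  obtain ⟨ε, -, hε⟩ := exists_sign_starSph_resSph h h'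
  refine ⟨ε • pstar h G', fun v => Submodule.smul_mem _ _ (pstar_mem_degSub h h1 v),
    fun i => ?_, fun u w => ?_⟩
  · rw [reflP_smul, reflP_pstar, h2, smul_neg]
  · rw [← h3, hε, AlternatingMap.smul_apply, MvPolynomial.smul_eval]

lemma exists_even_of_odd {m l k : ℕ} {r : ℤ} (h : l + (k + 1) = m) (h' : m - (1 + l) = k)
    {ζ : PForm m (k + 1)} (hζ : ∀ v, ζ v ∈ degSub m r) (ho : ∀ i, reflP i ζ = -ζ) :
    ∃ γ ∈ PLsph m l r, IsEvenSph m l γ ∧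
      ∀ (u : sphereSet m) w, castFormOn h' (starSph m l γ) u w =
        MvPolynomial.eval u.1 (ζ (Matrix.vecCons u.1 w)) := by
  have h₂ : (k + 1) + l = m := by omega
  obtain ⟨ε, hε1, hε⟩ := exists_sign_starSph_resSph h h'
  obtain ⟨δ, hδ1, hδ⟩ := exists_sign_pstar_pstar h₂ h
  have hneg : pstar h₂ (-ζ) = -pstar h₂ ζ := by
    ext1 v
    simp [pstar_apply]
  refine ⟨resSph m l (toForm ((ε * δ) • pstar h₂ ζ)), ⟨_, toForm_mem_PL fun v =>
    Submodule.smul_mem _ _ (pstar_mem_degSub h₂ hζ v), rfl⟩, fun i => ?_, fun u w => ?_⟩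
  · rw [← resSph_toForm_reflP, reflP_smul, reflP_pstar, ho, hneg, neg_neg]
  · rw [hε, pstar_smul, hδ]
    simp only [AlternatingMap.smul_apply, MvPolynomial.smul_eval]
    linear_combination (δ * δ * MvPolynomial.eval u.1 (ζ (Matrix.vecCons u.1 w))) * hε1 +
      MvPolynomial.eval u.1 (ζ (Matrix.vecCons u.1 w)) * hδ1

lemma pderiv_mem_degSub {m : ℕ} {r : ℤ} (a : Fin m) {p : MvPolynomial (Fin m) ℝ}
    (h : p ∈ degSub m r) : MvPolynomial.pderiv a p ∈ degSub m (r - 1) := by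
  rw [p.as_sum, map_sum]
  refine Submodule.sum_mem _ fun d hd => ?_
  have hdr := mem_degSub_iff_coeff.mp h d (MvPolynomial.mem_support_iff.mp hd)
  rw [MvPolynomial.pderiv_monomial, mem_degSub_iff_coeff]
  intro e he
  rw [MvPolynomial.coeff_monomial] at he
  split_ifs at he with hde
  · have hda : d a ≠ 0 := fun h0 => he (by simp [h0])
    have : (d - Finsupp.single a 1) + Finsupp.single a 1 = d :=
      tsub_add_cancel_of_le (Finsupp.single_le_iff.mpr (Nat.one_le_iff_ne_zero.mpr hda))
    rw [hde] at this
    have h2 := congrArg Finsupp.degree this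
    rw [map_add, Finsupp.degree_single] at h2
    omega
  · simp at he

lemma pderiv_reflAlg {m : ℕ} (i a : Fin m) (p : MvPolynomial (Fin m) ℝ) :
    MvPolynomial.pderiv a (reflAlg i p) = reflSign i a • reflAlg i (MvPolynomial.pderiv a p) := by
  induction p using MvPolynomial.induction_on' with
  | monomial d c =>
    rw [reflAlg_monomial, MvPolynomial.pderiv_monomial, MvPolynomial.pderiv_monomial,
      reflAlg_monomial, MvPolynomial.smul_monomial]
    congr 1
    by_cases h : a = i
    · subst h
      rcases hd : d a with _ | e
      · simp
      · simp [reflSign, hd, pow_succ, mul_assoc]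
    · simp [reflSign, h, mul_assoc]
  | add p q hp hq => rw [map_add, map_add, hp, hq, map_add, map_add, smul_add]

/-- The exterior derivative of a polynomial form. -/
def extd {m k : ℕ} (H : PForm m k) : PForm m (k + 1) :=
  AlternatingMap.alternatizeUncurryFin (∑ a : Fin m, (LinearMap.proj a : Vec m →ₗ[ℝ] ℝ).smulRight
    ((MvPolynomial.pderiv a).toLinearMap.compAlternatingMap H))

lemma extd_apply {m k : ℕ} (H : PForm m k) (v : Fin (k + 1) → Vec m) :
    extd H v = ∑ j : Fin (k + 1), (-1 : ℤ) ^ (j : ℕ) • ∑ a : Fin m, v j a •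
      MvPolynomial.pderiv a (H (j.removeNth v)) := by
  rw [extd, AlternatingMap.alternatizeUncurryFin_apply]
  refine Finset.sum_congr rfl fun j _ => ?_
  rw [LinearMap.sum_apply, alternatingMap_sum_apply]
  rfl

lemma reflP_extd {m k : ℕ} (i : Fin m) (H : PForm m k) :
    reflP i (extd H) = extd (reflP i H) := by
  ext1 v
  rw [reflP_apply, extd_apply, extd_apply, map_sum]
  refine Finset.sum_congr rfl fun j _ => ?_
  rw [map_zsmul, map_sum]
  congr 1
  refine Finset.sum_congr rfl fun a _ => ?_
  rw [reflP_apply, pderiv_reflAlg, map_smul, reflLin_apply, smul_smul, mul_comm (v j a)]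
  rfl

lemma extd_mem_degSub {m k : ℕ} {r : ℤ} {H : PForm m k} (h : ∀ v, H v ∈ degSub m r)
    (v : Fin (k + 1) → Vec m) : extd H v ∈ degSub m (r - 1) := by
  rw [extd_apply]
  refine Submodule.sum_mem _ fun j _ => zsmul_mem (Submodule.sum_mem _ fun a _ =>
    Submodule.smul_mem _ _ (pderiv_mem_degSub a (h _))) _

lemma sum_mul_eval_pderiv {m : ℕ} {N : ℤ} {p : MvPolynomial (Fin m) ℝ}
    (h : ∀ d, p.coeff d ≠ 0 → (d.degree : ℤ) = N) (u : Vec m) :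
    ∑ a, u a * MvPolynomial.eval u (MvPolynomial.pderiv a p) = N * MvPolynomial.eval u p := by
  rcases eq_or_ne p 0 with rfl | hp
  · simp
  · obtain ⟨d, hd⟩ := MvPolynomial.ne_zero_iff.mp hp
    have hN := h d hd
    have hh : p.IsHomogeneous N.toNat := by
      rw [MvPolynomial.IsHomogeneous, MvPolynomial.IsWeightedHomogeneous]
      intro e he
      have := h e he
      rw [Pi.one_def, ← Finsupp.degree_eq_weight_one] 
      omega
    have := congrArg (MvPolynomial.eval u) hh.sum_X_mul_pderiv
    simp only [map_sum, map_mul, MvPolynomial.eval_X, nsmul_eq_mul, map_natCast] at this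
    rw [this]
    congr 1
    exact_mod_cast (by omega : (N.toNat : ℤ) = N)

/-- Cartan's formula for the radial field, for a form annihilated by the radial field. -/
lemma eval_extd_vecCons {m k : ℕ} {N : ℤ} {H : PForm m k}
    (hN : ∀ v d, (H v).coeff d ≠ 0 → (d.degree : ℤ) = N)
    (h0 : ∀ u v j, v j = u → MvPolynomial.eval u (H v) = 0) (u : Vec m) (w : Fin k → Vec m) :
    MvPolynomial.eval u (extd H (Matrix.vecCons u w)) = (N + k) * MvPolynomial.eval u (H w) := by
  rw [extd_apply, Fin.sum_univ_succ, map_add]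
  have e1 : MvPolynomial.eval u ((-1 : ℤ) ^ ((0 : Fin (k + 1)) : ℕ) • ∑ a : Fin m,
      Matrix.vecCons u w 0 a • MvPolynomial.pderiv a (H (Fin.removeNth 0 (Matrix.vecCons u w)))) =
      N * MvPolynomial.eval u (H w) := by
    rw [← sum_mul_eval_pderiv (hN w)]
    simp [MvPolynomial.smul_eval, Fin.removeNth_zero, Matrix.vecCons]
  have e2 : ∀ j : Fin k, MvPolynomial.eval u ((-1 : ℤ) ^ (j.succ : ℕ) • ∑ a : Fin m,
      Matrix.vecCons u w j.succ a •
        MvPolynomial.pderiv a (H (Fin.removeNth j.succ (Matrix.vecCons u w)))) =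
      MvPolynomial.eval u (H w) := by
    intro j
    cases k with
    | zero => exact j.elim0
    | succ k =>
      have hr : Fin.removeNth j.succ (Matrix.vecCons u w) = Matrix.vecCons u (j.removeNth w) := by
        funext i
        refine Fin.cases ?_ (fun i => ?_) i <;> simp [Fin.removeNth]
      rw [hr]
      set z := j.removeNth w
      -- differentiate the vanishing contraction with the radial field
      have hE : ∑ b : Fin m, MvPolynomial.X b * H (Matrix.vecCons (Pi.single b 1) z) = 0 := by
        refine MvPolynomial.funext fun x => ?_
        rw [map_zero, ← h0 x (Matrix.vecCons x z) 0 rfl]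
        have : H (Matrix.vecCons x z) = ∑ b, x b • H (Matrix.vecCons (Pi.single b 1) z) := by
          have hx := congrArg (fun y => H.curryLeft y z) (pi_eq_sum_univ' x)
          simpa [alternatingMap_sum_apply] using hx
        rw [this]
        simp [MvPolynomial.smul_eval]
      have hD : ∀ a : Fin m, MvPolynomial.eval u (H (Matrix.vecCons (Pi.single a 1) z)) +
          MvPolynomial.eval u (MvPolynomial.pderiv a (H (Matrix.vecCons u z))) = 0 := by
        intro a
        have hu : H (Matrix.vecCons u z) = ∑ b, u b • H (Matrix.vecCons (Pi.single b 1) z) := by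
          have hx := congrArg (fun y => H.curryLeft y z) (pi_eq_sum_univ' u)
          simpa [alternatingMap_sum_apply] using hx
        have := congrArg (fun p => MvPolynomial.eval u (MvPolynomial.pderiv a p)) hE
        simp only [map_sum, MvPolynomial.pderiv_mul, map_add, map_mul, MvPolynomial.eval_X,
          map_zero, Finset.sum_add_distrib, MvPolynomial.pderiv_X] at this
        rw [hu]
        simp only [map_sum]
        rw [← this]
        congr 1
        · simp [Pi.single_apply, apply_ite]
        · simp only [Derivation.map_smul, MvPolynomial.smul_eval]
      have hw : H w = (-1 : ℤ) ^ (j : ℕ) • H (Matrix.vecCons (w j) z) := by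
        rw [← AlternatingMap.map_insertNth, Fin.insertNth_self_removeNth]
      have hwj : H (Matrix.vecCons (w j) z) =
          ∑ b, w j b • H (Matrix.vecCons (Pi.single b 1) z) := by
        have hx := congrArg (fun y => H.curryLeft y z) (pi_eq_sum_univ' (w j))
        simpa [alternatingMap_sum_apply] using hx
      rw [hw, hwj, map_zsmul, map_zsmul, map_sum, map_sum, Matrix.cons_val_succ, Fin.val_succ,
        pow_succ, mul_neg_one, neg_smul, ← smul_neg, ← Finset.sum_neg_distrib]
      congr 1
      refine Finset.sum_congr rfl fun a _ => ?_
      rw [MvPolynomial.smul_eval, MvPolynomial.smul_eval, eq_neg_of_add_eq_zero_left (hD a), mul_neg]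
  rw [e1, map_sum, Finset.sum_congr rfl fun j _ => e2 j]
  simp
  ring

/-- An odd homogeneous form annihilated by the radial field is the contraction with the radial
field of an odd form. -/
lemma exists_odd_radial_primitive {m k : ℕ} (hm : 0 < m) {N : ℤ} {H : PForm m k}
    (hN : ∀ v d, (H v).coeff d ≠ 0 → (d.degree : ℤ) = N)
    (h0 : ∀ u v j, v j = u → MvPolynomial.eval u (H v) = 0) (ho : ∀ i, reflP i H = -H) :
    ∃ ζ : PForm m (k + 1), (∀ v, ζ v ∈ degSub m (N - 1)) ∧ (∀ i, reflP i ζ = -ζ) ∧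
      ∀ u w, MvPolynomial.eval u (ζ (Matrix.vecCons u w)) = MvPolynomial.eval u (H w) := by
  refine ⟨((N : ℝ) + k)⁻¹ • extd H, fun v => Submodule.smul_mem _ _ (extd_mem_degSub
    (fun v => mem_degSub_iff_coeff.mpr fun d hd => (hN v d hd).le) v), fun i => ?_, fun u w => ?_⟩
  · rw [reflP_smul, reflP_extd, ho]
    ext1 v
    simp [extd_apply]
  · rw [AlternatingMap.smul_apply, MvPolynomial.smul_eval, eval_extd_vecCons hN h0, ← mul_assoc]
    by_cases hc : (N : ℝ) + k = 0
    · have hc' : N + (k : ℤ) = 0 := by exact_mod_cast hc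
      suffices H w = 0 by simp [this]
      ext d
      rw [MvPolynomial.coeff_zero]
      by_contra hd
      have hdN := hN w d hd
      obtain rfl : k = 0 := by omega
      have hd0 : d = 0 := by
        rw [← Finsupp.degree_eq_zero_iff]; omega
      have := congrArg (fun T => (T w).coeff d) (ho ⟨0, hm⟩)
      simp only [reflP_apply, coeff_reflAlg, AlternatingMap.neg_apply, MvPolynomial.coeff_neg, hd0,
        Subsingleton.elim (fun j => reflLin m ⟨0, hm⟩ (w j)) w] at this
      rw [hd0] at hd
      simp at this
      exact hd (by linarith)
    · rw [inv_mul_cancel₀ hc, one_mul]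

lemma dotLin_apply {m : ℕ} (u v : Vec m) : dotLin m u v = ∑ i, u i * v i := by
  simp [dotLin, LinearMap.sum_apply]

lemma dPhi_apply {m : ℕ} (u v : Vec m) (i : Fin m) : dPhi m u v i = 2 * u i * v i := by
  simp [dPhi]

lemma dPhi_self {m : ℕ} (u : Vec m) : dPhi m u u = (2 : ℝ) • Phi m u := by
  funext i
  simp [dPhi_apply, Phi]; ring

lemma projSim_eq_self {m : ℕ} {w : Vec m} (h : ∑ i, w i = 0) : projSim m w = w := by
  simp [projSim, sumLin, LinearMap.sum_apply, h]

lemma dotLin_projSph {m : ℕ} {u : Vec m} (hu : u ∈ sphereSet m) (v : Vec m) :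
    dotLin m u (projSph m u v) = 0 := by
  have h : dotLin m u u = 1 := by
    rw [dotLin_apply]; simpa [sphereSet, pow_two] using hu
  rw [projSph_apply, map_sub, map_smul, h]; simp

lemma sum_dPhi_projSph {m : ℕ} {u : Vec m} (hu : u ∈ sphereSet m) (v : Vec m) :
    ∑ i, dPhi m u (projSph m u v) i = 0 := by
  have := dotLin_projSph hu v
  rw [dotLin_apply] at this
  simp only [dPhi_apply, mul_assoc, ← Finset.mul_sum, this, mul_zero]

lemma phiPullTS_resSim_iU {m k : ℕ} (β : Form m (k + 1)) (u : sphereSet m) (v : Fin k → Vec m) :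
    phiPullTS m k (resSim m k (iU β)) u v =
      β (Phi m u) (Matrix.vecCons (Phi m u) fun j => dPhi m u (v j)) := by
  have h1 : ∀ j, projSim m (dPhi m u.1 (projSph m u.1 (v j))) =
      dPhi m u.1 (v j) - (2 * dotLin m u.1 (v j)) • Phi m u.1 := by
    intro j
    rw [projSim_eq_self (sum_dPhi_projSph u.2 _), projSph_apply, map_sub, map_smul, dPhi_self,
      smul_smul, mul_comm]
  rw [← map_vecCons_sub_smul (β (Phi m u.1)) (Phi m u.1) (fun j => 2 * dotLin m u.1 (v j))]
  simp only [← h1]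
  rfl

/-- Homogenization to degree `r - 1` using the function `∑ xᵢ`, which is `1` on the simplex. -/
def homogenize (m r : ℕ) : MvPolynomial (Fin m) ℝ →ₗ[ℝ] MvPolynomial (Fin m) ℝ :=
  ∑ j ∈ Finset.range r, (LinearMap.mulLeft ℝ ((∑ i, MvPolynomial.X i) ^ (r - 1 - j))).comp
    (MvPolynomial.homogeneousComponent j)

lemma homogenize_apply {m r : ℕ} (p : MvPolynomial (Fin m) ℝ) :
    homogenize m r p = ∑ j ∈ Finset.range r, (∑ i, MvPolynomial.X i) ^ (r - 1 - j) *
      MvPolynomial.homogeneousComponent j p := by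
  simp [homogenize, LinearMap.sum_apply]

lemma isHomogeneous_homogenize {m r : ℕ} (p : MvPolynomial (Fin m) ℝ) :
    (homogenize m r p).IsHomogeneous (r - 1) := by
  rw [homogenize_apply]
  refine MvPolynomial.IsHomogeneous.sum _ _ _ fun j hj => ?_
  have h1 : (∑ i : Fin m, MvPolynomial.X i : MvPolynomial (Fin m) ℝ).IsHomogeneous 1 :=
    MvPolynomial.IsHomogeneous.sum _ _ _ fun i _ => MvPolynomial.isHomogeneous_X _ _
  have := (h1.pow (r - 1 - j)).mul (MvPolynomial.homogeneousComponent_isHomogeneous j p)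
  have hjr := Finset.mem_range.mp hj
  convert this using 1
  omega

lemma eval_homogenize {m r : ℕ} {p : MvPolynomial (Fin m) ℝ} (hp : p ∈ degSub m ((r : ℤ) - 1))
    {x : Vec m} (hx : ∑ i, x i = 1) :
    MvPolynomial.eval x (homogenize m r p) = MvPolynomial.eval x p := by
  rw [homogenize_apply, map_sum]
  have h : ∀ j ∈ Finset.range r, MvPolynomial.eval x ((∑ i, MvPolynomial.X i) ^ (r - 1 - j) *
      MvPolynomial.homogeneousComponent j p) =
      MvPolynomial.eval x (MvPolynomial.homogeneousComponent j p) := by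
    intro j _
    simp [hx]
  rw [Finset.sum_congr rfl h, ← map_sum]
  congr 1
  ext d
  rw [MvPolynomial.coeff_sum]
  simp only [MvPolynomial.coeff_homogeneousComponent]
  rw [Finset.sum_ite_eq]
  by_cases hd : p.coeff d = 0
  · simp [hd]
  · have := mem_degSub_iff_coeff.mp hp d hd
    rw [if_pos (Finset.mem_range.mpr (by omega))]

lemma eval_expand_two {m : ℕ} (u : Vec m) (p : MvPolynomial (Fin m) ℝ) :
    MvPolynomial.eval u (MvPolynomial.expand 2 p) = MvPolynomial.eval (Phi m u) p := by
  rw [MvPolynomial.eval_expand]; rfl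

lemma exists_phiPull_iU {m k s : ℕ} {B : PForm m (k + 1)} (hB : ∀ v, (B v).IsHomogeneous s) :
    ∃ W : PForm m k, (∀ v, (W v).IsHomogeneous (2 * s + (k + 2))) ∧
      ∀ u v, MvPolynomial.eval u (W v) =
        toForm B (Phi m u) (Matrix.vecCons (Phi m u) fun j => dPhi m u (v j)) := by
  have key : ∀ v, ∃ p : MvPolynomial (Fin m) ℝ, p.IsHomogeneous (2 * s + (k + 2)) ∧
      ∀ u, phiPull m k (iU (toForm B)) u v = MvPolynomial.eval u p := by
    intro v
    refine ⟨∑ g : Fin (k + 1) → Fin m, MvPolynomial.expand 2 (B (frame g)) *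
      (MvPolynomial.X (g 0) ^ 2 *
        ∏ j : Fin k, MvPolynomial.C (2 * v j (g j.succ)) * MvPolynomial.X (g j.succ)), ?_, ?_⟩
    · refine MvPolynomial.IsHomogeneous.sum _ _ _ fun g _ => ?_
      have h1 : (MvPolynomial.expand 2 (B (frame g))).IsHomogeneous (2 * s) :=
        (hB (frame g)).aeval _ fun i => MvPolynomial.isHomogeneous_X_pow i 2
      have h2 : (∏ j : Fin k, MvPolynomial.C (2 * v j (g j.succ)) *
          (MvPolynomial.X (g j.succ) : MvPolynomial (Fin m) ℝ)).IsHomogeneous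
            (∑ _j : Fin k, 1) :=
        MvPolynomial.IsHomogeneous.prod _ _ _ fun j _ => MvPolynomial.isHomogeneous_C_mul_X _ _
      have := h1.mul ((MvPolynomial.isHomogeneous_X_pow (g 0) 2).mul h2)
      convert this using 2
      simp; omega
    · intro u
      have e : phiPull m k (iU (toForm B)) u v =
        toForm B (Phi m u) (Matrix.vecCons (Phi m u) fun j => dPhi m u (v j)) := rfl
      rw [e, map_eq_sum_frame, map_sum]
      refine Finset.sum_congr rfl fun g _ => ?_
      rw [toForm_apply, map_mul, eval_expand_two, Fin.prod_univ_succ, map_mul, map_pow, map_prod]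
      simp only [Matrix.cons_val_zero, Matrix.cons_val_succ, dPhi_apply, map_mul,
        MvPolynomial.eval_C, MvPolynomial.eval_X, smul_eq_mul]
      rw [mul_comm]
      congr 2
      refine Finset.prod_congr rfl fun j _ => ?_
      ring
  obtain ⟨W, h1, h2⟩ := exists_pform key
  refine ⟨W, h1, fun u v => ?_⟩
  rw [← toForm_apply, h2]
  rfl

lemma X_dvd_of_eval_eq_zero {m : ℕ} (i : Fin m) {p : MvPolynomial (Fin m) ℝ}
    (h : ∀ x : Vec m, x i = 0 → MvPolynomial.eval x p = 0) : MvPolynomial.X i ∣ p := by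
  let f : MvPolynomial (Fin m) ℝ →ₐ[ℝ] MvPolynomial (Fin m) ℝ :=
    MvPolynomial.aeval fun j => if j = i then 0 else MvPolynomial.X j
  have hf : f p = 0 := by
    refine MvPolynomial.funext fun x => ?_
    have h2 : (MvPolynomial.aeval x).comp f =
        (MvPolynomial.aeval (Function.update x i 0) : MvPolynomial (Fin m) ℝ →ₐ[ℝ] ℝ) := by
      refine MvPolynomial.algHom_ext fun j => ?_
      by_cases hj : j = i
      · subst hj; simp [f]
      · simp [f, hj]
    have h3 := DFunLike.congr_fun h2 p
    simp only [AlgHom.comp_apply, MvPolynomial.aeval_eq_eval] at h3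
    rw [map_zero]
    exact h3.trans (h _ (by simp))
  have hq : (Ideal.Quotient.mkₐ ℝ (Ideal.span {(MvPolynomial.X i : MvPolynomial (Fin m) ℝ)})).comp f =
      Ideal.Quotient.mkₐ ℝ (Ideal.span {(MvPolynomial.X i : MvPolynomial (Fin m) ℝ)}) := by
    refine MvPolynomial.algHom_ext fun j => ?_
    by_cases hj : j = i
    · subst hj
      simp only [f, AlgHom.comp_apply, MvPolynomial.aeval_X, if_true, map_zero]
      rw [eq_comm, Ideal.Quotient.mkₐ_eq_mk, Ideal.Quotient.eq_zero_iff_mem]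
      exact Ideal.mem_span_singleton_self _
    · simp [f, hj]
  have h4 := DFunLike.congr_fun hq p
  rw [AlgHom.comp_apply, hf, map_zero, eq_comm, Ideal.Quotient.mkₐ_eq_mk,
    Ideal.Quotient.eq_zero_iff_mem, Ideal.mem_span_singleton] at h4
  exact h4

lemma prod_X_dvd_of_eval_eq_zero {m : ℕ} {p : MvPolynomial (Fin m) ℝ}
    (h : ∀ (x : Vec m) (i : Fin m), x i = 0 → MvPolynomial.eval x p = 0) :
    ∏ i : Fin m, MvPolynomial.X i ∣ p := by
  refine Finset.prod_dvd_of_isRelPrime (fun i _ j _ hij => ?_) fun i _ =>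
    X_dvd_of_eval_eq_zero i fun x hx => h x i hx
  exact (MvPolynomial.X_prime.irreducible.isRelPrime_iff_not_dvd).mpr
    fun hd => hij (MvPolynomial.X_dvd_X.mp hd)

lemma exists_pform_mul {m k : ℕ} {q : MvPolynomial (Fin m) ℝ} (hq : q ≠ 0) {F : PForm m k}
    (h : ∀ v, q ∣ F v) : ∃ H : PForm m k, ∀ v, F v = q * H v := by
  choose f hf using h
  refine ⟨{ toFun := f, map_update_add' := ?_, map_update_smul' := ?_, map_eq_zero_of_eq' := ?_ },
    hf⟩
  · intro _ v i x y
    refine mul_left_cancel₀ hq ?_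
    rw [mul_add, ← hf, ← hf, ← hf, ← F.map_update_add]
  · intro _ v i c x
    refine mul_left_cancel₀ hq ?_
    rw [mul_smul_comm, ← hf, ← hf, ← F.map_update_smul]
  · intro v i j hv hij
    refine mul_left_cancel₀ hq ?_
    rw [← hf, mul_zero, F.map_eq_zero_of_eq v hv hij]

lemma prod_X_eq_monomial (m : ℕ) : (∏ i : Fin m, MvPolynomial.X i : MvPolynomial (Fin m) ℝ) =
    MvPolynomial.monomial (∑ i : Fin m, Finsupp.single i 1) 1 := by
  simp only [MvPolynomial.X, MvPolynomial.monomial_sum_one]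

lemma coeff_prod_X_mul {m : ℕ} (p : MvPolynomial (Fin m) ℝ) (d : Fin m →₀ ℕ) :
    ((∏ i : Fin m, MvPolynomial.X i) * p).coeff ((∑ i : Fin m, Finsupp.single i 1) + d) =
      p.coeff d := by
  rw [prod_X_eq_monomial, MvPolynomial.coeff_monomial_mul, one_mul]

lemma degree_sum_single (m : ℕ) :
    (∑ i : Fin m, Finsupp.single i 1 : Fin m →₀ ℕ).degree = m := by
  simp [map_sum, Finsupp.degree_single]

lemma eval_prod_X {m : ℕ} (u : Vec m) :
    MvPolynomial.eval u (∏ i : Fin m, MvPolynomial.X i) = bubble m u := by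
  simp [bubble]

lemma eval_smul_of_isHomogeneous {m N : ℕ} {p : MvPolynomial (Fin m) ℝ} (hp : p.IsHomogeneous N)
    (c : ℝ) (u : Vec m) :
    MvPolynomial.eval (c • u) p = c ^ N * MvPolynomial.eval u p := by
  rw [MvPolynomial.eval_eq', MvPolynomial.eval_eq', Finset.mul_sum]
  refine Finset.sum_congr rfl fun d hd => ?_
  have h := hp.degree_eq_sum_deg_support hd
  simp only [Pi.smul_apply, smul_eq_mul, mul_pow, Finset.prod_mul_distrib]
  have h2 : ∑ i, d i = N := by
    rw [h]; exact (Finset.sum_subset (Finset.subset_univ _) (by simp)).symm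
  rw [Finset.prod_pow_eq_pow_sum, h2]
  ring

lemma reflAlg_prod_X {m : ℕ} (i : Fin m) :
    reflAlg i (∏ j : Fin m, MvPolynomial.X j) = -∏ j : Fin m, MvPolynomial.X j := by
  rw [prod_X_eq_monomial, reflAlg_monomial]
  simp [Finsupp.finsetSum_apply, Finsupp.single_apply]

/-- The pullback of a form with vanishing trace is the bubble function times the radial contraction
of an odd form. -/
lemma exists_odd_of_mem_PLmosim {m k r : ℕ} (hm : 0 < m) (hr : 1 ≤ r)
    {a : FormOn m (simplexSet m) k} (ha : a ∈ PLmosim m k (r : ℤ)) :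
    ∃ ζ : PForm m (k + 1), (∀ v, ζ v ∈ degSub m (2 * r + k - m - 1)) ∧
      (∀ i, reflP i ζ = -ζ) ∧ ∀ (u : sphereSet m) w, phiPullTS m k a u w =
        bubble m u * MvPolynomial.eval u.1 (ζ (Matrix.vecCons u.1 w)) := by
  obtain ⟨⟨_, ⟨β, hβ, rfl⟩, rfl⟩, hbd⟩ := ha
  obtain ⟨B₀, hB₀, rfl⟩ := exists_toForm_eq hβ
  obtain ⟨W, hW, hWe⟩ := exists_phiPull_iU
    (B := (homogenize m r).compAlternatingMap B₀) (s := r - 1) fun v => isHomogeneous_homogenize _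
  have hpull : ∀ (u : sphereSet m) v, phiPullTS m k (resSim m k (iU (toForm B₀))) u v =
      MvPolynomial.eval u.1 (W v) := by
    intro u v
    rw [phiPullTS_resSim_iU, hWe, toForm_apply, toForm_apply, LinearMap.compAlternatingMap_apply,
      eval_homogenize (hB₀ _) (phi_mem_simplex u.2).2]
  have hzero : ∀ (u : sphereSet m) (i : Fin m) v, u.1 i = 0 → MvPolynomial.eval u.1 (W v) = 0 := by
    intro u i v hu
    rw [← hpull]
    refine hbd ⟨Phi m u.1, phi_mem_simplex u.2⟩ i (by simp [Phi, hu]) _ fun j => ⟨?_, ?_⟩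
    · exact sum_dPhi_projSph u.2 _
    · simp [dPhi_apply, hu]
  have hzero' : ∀ (x : Vec m) (i : Fin m) v, x i = 0 → MvPolynomial.eval x (W v) = 0 := by
    intro x i v hx
    by_cases hs : ∑ j, x j ^ 2 = 0
    · have hx0 : x = (0 : ℝ) • x := by
        funext j
        have := (Finset.sum_eq_zero_iff_of_nonneg fun j _ => sq_nonneg (x j)).mp hs j
          (Finset.mem_univ j)
        simpa using this
      rw [hx0, eval_smul_of_isHomogeneous (hW v), zero_pow (by omega), zero_mul]
    · have hpos : 0 < ∑ j, x j ^ 2 := lt_of_le_of_ne (Finset.sum_nonneg fun j _ => sq_nonneg _)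
        (Ne.symm hs)
      have hmem : (Real.sqrt (∑ j, x j ^ 2))⁻¹ • x ∈ sphereSet m := by
        simp only [sphereSet, Set.mem_ofPred_eq, Pi.smul_apply, smul_eq_mul, mul_pow,
          ← Finset.mul_sum, inv_pow, Real.sq_sqrt hpos.le]
        exact inv_mul_cancel₀ hs
      have := hzero ⟨_, hmem⟩ i v (by simp [hx])
      rw [eval_smul_of_isHomogeneous (hW v)] at this
      exact (mul_eq_zero.mp this).resolve_left
        (pow_ne_zero _ (inv_ne_zero (Real.sqrt_pos.mpr hpos).ne'))
  have hX0 : (∏ i : Fin m, MvPolynomial.X i : MvPolynomial (Fin m) ℝ) ≠ 0 :=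
    Finset.prod_ne_zero_iff.mpr fun i _ => MvPolynomial.X_ne_zero i
  obtain ⟨H, hH⟩ := exists_pform_mul hX0 fun v =>
    prod_X_dvd_of_eval_eq_zero fun x i hx => hzero' x i v hx
  have hcancel : ∀ p : MvPolynomial (Fin m) ℝ,
      (∏ i : Fin m, MvPolynomial.X i) * p = 0 → p = 0 := fun p hp =>
    (mul_eq_zero.mp hp).resolve_left hX0
  suffices h : ∃ ζ : PForm m (k + 1), (∀ v, ζ v ∈ degSub m (2 * r + k - m - 1)) ∧
      (∀ i, reflP i ζ = -ζ) ∧ ∀ u w, MvPolynomial.eval u (ζ (Matrix.vecCons u w)) =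
        MvPolynomial.eval u (H w) by
    obtain ⟨ζ, h1, h2, h3⟩ := h
    refine ⟨ζ, h1, h2, fun u w => ?_⟩
    rw [hpull, hH, map_mul, h3, eval_prod_X]
  refine exists_odd_radial_primitive hm ?_ ?_ ?_
  · intro v d hd
    rw [← coeff_prod_X_mul, ← hH] at hd
    have := hW v hd
    rw [Pi.one_def, ← Finsupp.degree_eq_weight_one, map_add, degree_sum_single] at this
    omega
  · intro u v j hv
    have hlin : ∃ p : MvPolynomial (Fin m) ℝ, p = ∑ a : Fin m, MvPolynomial.X a *
        H (Function.update v j (Pi.single a 1)) := ⟨_, rfl⟩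
    obtain ⟨p, hp⟩ := hlin
    have hev : ∀ (F : PForm m k) (x : Vec m), MvPolynomial.eval x (F (Function.update v j x)) =
        MvPolynomial.eval x (∑ a : Fin m, MvPolynomial.X a *
          F (Function.update v j (Pi.single a 1))) := by
      intro F x
      conv_lhs => rw [pi_eq_sum_univ' x, F.map_update_sum]
      simp [F.map_update_smul, MvPolynomial.smul_eval, ← pi_eq_sum_univ']
    have hp0 : p = 0 := by
      refine hcancel p (MvPolynomial.funext fun x => ?_)
      have hWx : MvPolynomial.eval x (W (Function.update v j x)) = 0 := by
        rw [hWe]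
        have hc : (Matrix.vecCons (Phi m x) fun i => dPhi m x (Function.update v j x i)) =
            Function.update (Matrix.vecCons (Phi m x) fun i => dPhi m x (Function.update v j x i))
              j.succ ((2 : ℝ) • Phi m x) := by
          rw [eq_comm, Function.update_eq_self_iff]
          simp [dPhi_self]
        rw [hc, AlternatingMap.map_update_smul]
        have h0 := (toForm ((homogenize m r).compAlternatingMap B₀) (Phi m x)).map_update_self
          (Matrix.vecCons (Phi m x) fun i => dPhi m x (Function.update v j x i))
          (i := j.succ) (j := 0) (Fin.succ_ne_zero j)
        rw [Matrix.cons_val_zero] at h0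
        rw [h0, smul_zero]
      rw [hH, map_mul, hev H, ← hp, ← map_mul] at hWx
      rw [hWx, map_zero]
    have := hev H u
    rw [← hp, hp0, map_zero] at this
    rw [← hv, Function.update_eq_self] at this
    rwa [← hv]
  · intro i
    ext1 v
    have hWr : reflP i W = W := by
      refine pform_ext fun x v => ?_
      rw [toForm_apply, toForm_apply, reflP_apply, eval_reflAlg, hWe, hWe]
      have e1 : Phi m (reflLin m i x) = Phi m x := by
        funext j
        simp only [Phi, reflLin_apply, pow_two]
        linear_combination (x j * x j) * reflSign_mul_self i j
      have e2 : ∀ y, dPhi m (reflLin m i x) (reflLin m i y) = dPhi m x y := by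
        intro y
        funext j
        simp only [dPhi_apply, reflLin_apply]
        linear_combination (2 * x j * y j) * reflSign_mul_self i j
      rw [e1]
      simp only [e2]
    have := congrArg (fun T => T v) hWr
    simp only [reflP_apply, hH, map_mul, reflAlg_prod_X] at this
    refine mul_left_cancel₀ hX0 ?_
    rw [reflP_apply, AlternatingMap.neg_apply]
    linear_combination -this

/-- The linear map halving all exponents, rounding down. -/
def halve (m : ℕ) : MvPolynomial (Fin m) ℝ →ₗ[ℝ] MvPolynomial (Fin m) ℝ :=
  (MvPolynomial.basisMonomials (Fin m) ℝ).constr ℝ fun d =>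
    MvPolynomial.monomial (d.mapRange (· / 2) rfl) 1

lemma halve_monomial {m : ℕ} (d : Fin m →₀ ℕ) (c : ℝ) :
    halve m (MvPolynomial.monomial d c) = MvPolynomial.monomial (d.mapRange (· / 2) rfl) c := by
  have h : MvPolynomial.monomial d c = c • MvPolynomial.basisMonomials (Fin m) ℝ d := by
    simp [MvPolynomial.smul_monomial]
  rw [h, map_smul, halve, Module.Basis.constr_basis, MvPolynomial.smul_monomial, smul_eq_mul, mul_one]

lemma halve_eq_sum {m : ℕ} (p : MvPolynomial (Fin m) ℝ) :
    halve m p = ∑ d ∈ p.support, MvPolynomial.monomial (d.mapRange (· / 2) rfl) (p.coeff d) := by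
  conv_lhs => rw [p.as_sum]
  simp only [map_sum, halve_monomial]

lemma monomial_mem_degSub {m : ℕ} {r : ℤ} {d : Fin m →₀ ℕ} (h : (d.degree : ℤ) ≤ r) (c : ℝ) :
    MvPolynomial.monomial d c ∈ degSub m r := by
  refine mem_degSub_iff_coeff.mpr fun e he => ?_
  rw [MvPolynomial.coeff_monomial] at he
  split at he
  · next hd => rwa [← hd]
  · exact absurd rfl he

lemma sum_mod_two {m k : ℕ} {g : Fin k → Fin m} (hg : Function.Injective g) {d : Fin m →₀ ℕ}
    (hd : ∀ i, Odd (d i) ↔ i ∈ Set.range g) : ∑ i, d i % 2 = k := by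
  have h : ∀ i, d i % 2 = if i ∈ Finset.univ.image g then 1 else 0 := by
    intro i
    have := hd i
    rw [Nat.odd_iff] at this
    simp only [Finset.mem_image, Finset.mem_univ, true_and]
    split
    · next hi => exact this.mpr hi
    · next hi => have := mt this.mp hi; omega
  simp only [h, Finset.sum_ite_mem, Finset.univ_inter]
  rw [Finset.sum_const, Finset.card_image_of_injective _ hg]
  simp

lemma prod_pow_mod_two {m k : ℕ} {g : Fin k → Fin m} (hg : Function.Injective g) {d : Fin m →₀ ℕ}
    (hd : ∀ i, Odd (d i) ↔ i ∈ Set.range g) (u : Vec m) :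
    ∏ j, u (g j) = ∏ i, u i ^ (d i % 2) := by
  have h : ∀ i, u i ^ (d i % 2) = if i ∈ Finset.univ.image g then u i else 1 := by
    intro i
    have := hd i
    rw [Nat.odd_iff] at this
    simp only [Finset.mem_image, Finset.mem_univ, true_and]
    split
    · next hi => rw [this.mpr hi, pow_one]
    · next hi =>
      have := mt this.mp hi
      rw [show d i % 2 = 0 by omega, pow_zero]
  simp only [h, Finset.prod_ite_mem, Finset.univ_inter]
  rw [Finset.prod_image fun _ _ _ _ e => hg e]

lemma eval_halve {m k : ℕ} {g : Fin k → Fin m} (hg : Function.Injective g)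
    {p : MvPolynomial (Fin m) ℝ} (hp : ∀ d, p.coeff d ≠ 0 → ∀ i, Odd (d i) ↔ i ∈ Set.range g)
    (u : Vec m) :
    (∏ j, u (g j)) * MvPolynomial.eval (Phi m u) (halve m p) = MvPolynomial.eval u p := by
  conv_rhs => rw [p.as_sum]
  rw [halve_eq_sum, map_sum, map_sum, Finset.mul_sum]
  refine Finset.sum_congr rfl fun d hd => ?_
  rw [prod_pow_mod_two hg (hp d (MvPolynomial.mem_support_iff.mp hd)), MvPolynomial.eval_monomial,
    MvPolynomial.eval_monomial, Finsupp.prod_fintype _ _ (fun _ => pow_zero _),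
    Finsupp.prod_fintype _ _ (fun _ => pow_zero _), mul_left_comm, ← Finset.prod_mul_distrib]
  congr 1
  refine Finset.prod_congr rfl fun i _ => ?_
  rw [Finsupp.mapRange_apply, Phi, ← pow_mul, ← pow_add, Nat.mod_add_div]

lemma halve_mem_degSub {m k : ℕ} {r : ℤ} {g : Fin k → Fin m} (hg : Function.Injective g)
    {p : MvPolynomial (Fin m) ℝ} (hp : ∀ d, p.coeff d ≠ 0 → ∀ i, Odd (d i) ↔ i ∈ Set.range g)
    (h : p ∈ degSub m (2 * r + k)) : halve m p ∈ degSub m r := by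
  rw [halve_eq_sum]
  refine Submodule.sum_mem _ fun d hd => monomial_mem_degSub ?_ _
  have hd := MvPolynomial.mem_support_iff.mp hd
  have h1 := mem_degSub_iff_coeff.mp h d hd
  have h2 := sum_mod_two hg (hp d hd)
  rw [Finsupp.degree_eq_sum] at h1 ⊢
  simp only [Finsupp.mapRange_apply]
  have h3 : ∑ i, d i = ∑ i, d i % 2 + 2 * ∑ i, d i / 2 := by
    rw [Finset.mul_sum, ← Finset.sum_add_distrib]
    exact Finset.sum_congr rfl fun i _ => (Nat.mod_add_div _ _).symm
  omega

lemma eval_halve_eq_zero {m : ℕ} {p : MvPolynomial (Fin m) ℝ} {i : Fin m}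
    (hp : ∀ d, p.coeff d ≠ 0 → 2 ≤ d i) {x : Vec m} (hx : x i = 0) :
    MvPolynomial.eval x (halve m p) = 0 := by
  rw [halve_eq_sum, map_sum]
  refine Finset.sum_eq_zero fun d hd => ?_
  have := hp d (MvPolynomial.mem_support_iff.mp hd)
  rw [MvPolynomial.eval_monomial, Finsupp.prod_fintype _ _ (fun _ => pow_zero _),
    Finset.prod_eq_zero (Finset.mem_univ i), mul_zero]
  rw [Finsupp.mapRange_apply, hx, zero_pow (by omega)]

lemma prod_reflSign {m k : ℕ} (i : Fin m) {g : Fin k → Fin m} (hg : Function.Injective g) :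
    (i ∈ Set.range g → ∏ j, reflSign i (g j) = -1) ∧
      (i ∉ Set.range g → ∏ j, reflSign i (g j) = 1) := by
  constructor
  · rintro ⟨j, rfl⟩
    refine (Fintype.prod_eq_single j fun b hb => ?_).trans (if_pos rfl)
    exact if_neg fun e => hb (hg e)
  · intro hi
    exact Finset.prod_eq_one fun j _ => if_neg fun e => hi ⟨j, e⟩

lemma odd_iff_of_reflP_eq_self {m k : ℕ} {A : PForm m k} (hA : ∀ i, reflP i A = A)
    {g : Fin k → Fin m} (hg : Function.Injective g) (d : Fin m →₀ ℕ)
    (hd : (A (frame g)).coeff d ≠ 0) (i : Fin m) : Odd (d i) ↔ i ∈ Set.range g := by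
  have h := congrArg (fun T => (T (frame g)).coeff d) (hA i)
  simp only [reflP_apply, map_reflLin_frame, map_smul, MvPolynomial.coeff_smul, coeff_reflAlg,
    smul_eq_mul, ← mul_assoc] at h
  have h1 := (mul_eq_right₀ hd).mp h
  by_cases hi : i ∈ Set.range g
  · rw [(prod_reflSign i hg).1 hi] at h1
    refine iff_of_true ?_ hi
    by_contra ho
    rw [(Nat.not_odd_iff_even.mp ho).neg_one_pow] at h1
    norm_num at h1
  · rw [(prod_reflSign i hg).2 hi] at h1
    refine iff_of_false (fun ho => ?_) hi
    rw [ho.neg_one_pow] at h1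
    norm_num at h1

lemma map_frame_of_not_injective {m k : ℕ} {N : Type*} [AddCommGroup N] [Module ℝ N]
    (f : Vec m [⋀^Fin k]→ₗ[ℝ] N) {g : Fin k → Fin m} (hg : ¬ Function.Injective g) :
    f (frame g) = 0 := by
  refine f.map_eq_zero_of_not_injective _ fun h => hg fun a b e => h ?_
  simp only [frame, e]

/-- The bubble function times the radial contraction of an odd form is the pullback of a form with
vanishing trace. -/
lemma exists_mem_PLmosim_of_odd {m k r : ℕ} {ζ : PForm m (k + 1)}
    (hζ : ∀ v, ζ v ∈ degSub m (2 * r + k - m - 1)) (ho : ∀ i, reflP i ζ = -ζ) :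
    ∃ a ∈ PLmosim m k (r : ℤ), ∀ (u : sphereSet m) w, phiPullTS m k a u w =
        bubble m u * MvPolynomial.eval u.1 (ζ (Matrix.vecCons u.1 w)) := by
  set A : PForm m (k + 1) :=
    (LinearMap.mulLeft ℝ (∏ i : Fin m, MvPolynomial.X i)).compAlternatingMap ζ with hA
  have hAv : ∀ v, A v = (∏ i : Fin m, MvPolynomial.X i) * ζ v := fun v => rfl
  have hAe : ∀ i, reflP i A = A := by
    intro i
    ext1 v
    have := congrArg (fun T => T v) (ho i)
    simp only [reflP_apply, AlternatingMap.neg_apply] at this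
    rw [reflP_apply, hAv, hAv, map_mul, reflAlg_prod_X, this]
    ring
  have hcoeff : ∀ v d, (A v).coeff d ≠ 0 → (∀ i, 1 ≤ d i) ∧
      (d.degree : ℤ) ≤ 2 * ((r : ℤ) - 1) + ((k + 1 : ℕ) : ℤ) := by
    intro v d hd
    rw [hAv, prod_X_eq_monomial, MvPolynomial.coeff_monomial_mul'] at hd
    split at hd
    · next hle =>
      obtain ⟨e, rfl⟩ := exists_add_of_le hle
      rw [one_mul, add_tsub_cancel_left] at hd
      have := mem_degSub_iff_coeff.mp (hζ v) e hd
      refine ⟨fun i => ?_, ?_⟩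
      · simp [Finsupp.single_apply]
      · rw [map_add, degree_sum_single]; push_cast; omega
    · exact absurd rfl hd
  set B : PForm m (k + 1) := ((1 / 2 : ℝ) ^ k) • (halve m).compAlternatingMap A with hB
  have hBv : ∀ v, B v = (1 / 2 : ℝ) ^ k • halve m (A v) := fun v => rfl
  have hBd : ∀ v, B v ∈ degSub m ((r : ℤ) - 1) := by
    intro v
    rw [map_eq_sum_frame]
    refine Submodule.sum_mem _ fun g _ => Submodule.smul_mem _ _ ?_
    rw [hBv]
    refine Submodule.smul_mem _ _ ?_
    by_cases hg : Function.Injective g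
    · exact halve_mem_degSub hg (odd_iff_of_reflP_eq_self hAe hg)
        (mem_degSub_iff_coeff.mpr fun d hd => (hcoeff _ d hd).2)
    · rw [map_frame_of_not_injective A hg, map_zero]
      exact Submodule.zero_mem _
  refine ⟨resSim m k (iU (toForm B)), ⟨⟨_, ⟨_, toForm_mem_PL hBd, rfl⟩, rfl⟩, ?_⟩, ?_⟩
  · intro x i hx v hv
    have e : resSim m k (iU (toForm B)) x v = MvPolynomial.eval x.1 (B (Matrix.vecCons x.1 v)) := by
      have : ∀ j, projSim m (v j) = v j := fun j => projSim_eq_self (hv j).1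
      simp only [resSim, AlternatingMap.compLinearMap_apply, this]
      rfl
    rw [e, map_eq_sum_frame, map_sum]
    refine Finset.sum_eq_zero fun g _ => ?_
    rw [MvPolynomial.smul_eval]
    by_cases hi : i ∈ Set.range g
    · obtain ⟨j, rfl⟩ := hi
      rw [Finset.prod_eq_zero (Finset.mem_univ j), zero_mul]
      refine Fin.cases (fun hx => ?_) (fun j _ hv => ?_) j hx fun j => (hv j).2
      · exact fun _ => hx
      · exact hv j
    · rw [hBv, MvPolynomial.smul_eval]
      by_cases hg : Function.Injective g
      · rw [eval_halve_eq_zero (i := i) _ hx, mul_zero, mul_zero]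
        intro d hd
        have h1 := (odd_iff_of_reflP_eq_self hAe hg d hd i).not.mpr hi
        have h2 := (hcoeff _ d hd).1 i
        rw [Nat.odd_iff] at h1
        omega
      · rw [map_frame_of_not_injective A hg]; simp
  · intro u w
    rw [phiPullTS_resSim_iU, toForm_apply, ← eval_prod_X, ← map_mul, ← hAv, map_eq_sum_frame,
      map_eq_sum_frame A, map_sum, map_sum]
    refine Finset.sum_congr rfl fun g _ => ?_
    rw [MvPolynomial.smul_eval, MvPolynomial.smul_eval, hBv, MvPolynomial.smul_eval]
    by_cases hg : Function.Injective g
    · rw [← eval_halve hg (odd_iff_of_reflP_eq_self hAe hg) u.1]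
      simp only [Fin.prod_univ_succ, Matrix.cons_val_zero, Matrix.cons_val_succ, dPhi_apply,
        Finset.prod_mul_distrib, Finset.prod_const, Finset.card_univ, Fintype.card_fin, Phi]
      have h2 : (2 : ℝ) ^ k * (1 / 2) ^ k = 1 := by
        rw [← mul_pow]; norm_num
      linear_combination (u.1 (g 0) ^ 2 * (∏ j : Fin k, u.1 (g j.succ)) *
        (∏ j : Fin k, w j (g j.succ)) *
        MvPolynomial.eval (Phi m u.1) (halve m (A (frame g)))) * h2
    · rw [map_frame_of_not_injective A hg]; simp

lemma sum_projSim {m : ℕ} (hm : 0 < m) (w : Vec m) : ∑ i, projSim m w i = 0 := by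
  have : (m : ℝ) ≠ 0 := by positivity
  simp [projSim, sumLin, LinearMap.sum_apply, this]

lemma eq_of_phiPullTS_eq_of_pos {m k : ℕ} (hm : 0 < m) {α β : Form m k}
    (h : phiPullTS m k (resSim m k α) = phiPullTS m k (resSim m k β)) {x : simplexSet m}
    (hx : ∀ i, 0 < x.1 i) : resSim m k α x = resSim m k β x := by
  have hu : (fun i => Real.sqrt (x.1 i)) ∈ sphereSet m := by
    simp only [sphereSet, Set.mem_ofPred_eq, Real.sq_sqrt (hx _).le]
    exact x.2.2
  have hphi : Phi m (fun i => Real.sqrt (x.1 i)) = x.1 := funext fun i => Real.sq_sqrt (hx i).le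
  ext w
  obtain ⟨v, hv⟩ : ∃ v : Fin k → Vec m, v = fun j i =>
    projSim m (w j) i / (2 * Real.sqrt (x.1 i)) := ⟨_, rfl⟩
  have hne : ∀ i, Real.sqrt (x.1 i) ≠ 0 := fun i => (Real.sqrt_pos.mpr (hx i)).ne'
  have h1 : ∀ j, projSph m (fun i => Real.sqrt (x.1 i)) (v j) = v j := by
    intro j
    have : dotLin m (fun i => Real.sqrt (x.1 i)) (v j) = 0 := by
      rw [dotLin_apply, ← mul_right_inj' (two_ne_zero' ℝ), mul_zero, Finset.mul_sum,
        ← sum_projSim hm (w j)]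
      refine Finset.sum_congr rfl fun i _ => ?_
      have := hne i
      rw [hv]
      field_simp
    rw [projSph_apply, this, zero_smul, sub_zero]
  have h2 : ∀ j, dPhi m (fun i => Real.sqrt (x.1 i)) (v j) = projSim m (w j) := by
    intro j
    funext i
    have := hne i
    rw [dPhi_apply, hv]
    field_simp
  have h3 : ∀ γ : Form m k, phiPullTS m k (resSim m k γ) ⟨_, hu⟩ v = resSim m k γ x w := by
    intro γ
    simp only [phiPullTS, hphi, AlternatingMap.compLinearMap_apply, LinearMap.comp_apply, h1, h2,
      resSim, projSim_eq_self (sum_projSim hm _)]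
  rw [← h3, ← h3, h]

lemma continuous_iU_toForm {m k : ℕ} (B : PForm m (k + 1)) (v : Fin k → Vec m) :
    Continuous fun x => iU (toForm B) x v := by
  have h : (fun x => iU (toForm B) x v) = fun x => ∑ g : Fin (k + 1) → Fin m,
      (x (g 0) * ∏ j, v j (g j.succ)) * MvPolynomial.eval x (B (frame g)) := by
    funext x
    have e : iU (toForm B) x v = MvPolynomial.eval x (B (Matrix.vecCons x v)) := rfl
    rw [e, map_eq_sum_frame, map_sum]
    simp only [MvPolynomial.smul_eval, Fin.prod_univ_succ, Matrix.cons_val_zero,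
      Matrix.cons_val_succ]
  rw [h]
  refine continuous_finsetSum _ fun g _ => ?_
  exact ((continuous_apply _).mul continuous_const).mul (MvPolynomial.continuous_eval _)

lemma injOn_phiPullTS {m k : ℕ} (hm : 0 < m) (r : ℤ) :
    Set.InjOn (phiPullTS m k) (PLmsim m k r) := by
  rintro _ ⟨_, ⟨α, hα, rfl⟩, rfl⟩ _ ⟨_, ⟨β, hβ, rfl⟩, rfl⟩ h
  obtain ⟨A, -, rfl⟩ := exists_toForm_eq hα
  obtain ⟨B, -, rfl⟩ := exists_toForm_eq hβ
  funext x
  ext w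
  have hm' : (0 : ℝ) < m := by exact_mod_cast hm
  let y : ℝ → Vec m := fun t i => (1 - t) * x.1 i + t * (m : ℝ)⁻¹
  have hy : Continuous y := by fun_prop
  have hy0 : y 0 = x.1 := by funext i; simp [y]
  have heq : Set.EqOn (fun t => iU (toForm A) (y t) fun j => projSim m (w j))
      (fun t => iU (toForm B) (y t) fun j => projSim m (w j)) (Set.Ioo 0 1) := by
    intro t ht
    have hpos : ∀ i, 0 < y t i := fun i =>
      add_pos_of_nonneg_of_pos (mul_nonneg (sub_nonneg.mpr ht.2.le) (x.2.1 i))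
        (mul_pos ht.1 (inv_pos.mpr hm'))
    have hmem : y t ∈ simplexSet m := by
      refine ⟨fun i => (hpos i).le, ?_⟩
      simp only [y, Finset.sum_add_distrib, ← Finset.mul_sum, x.2.2, Finset.sum_const,
        Finset.card_univ, Fintype.card_fin, nsmul_eq_mul, mul_inv_cancel₀ hm'.ne']
      ring
    exact congrArg (fun T => T w) (eq_of_phiPullTS_eq_of_pos hm h (x := ⟨y t, hmem⟩) hpos)
  have h0 : (0 : ℝ) ∈ closure (Set.Ioo (0 : ℝ) 1) := by
    rw [closure_Ioo zero_ne_one]; exact ⟨le_rfl, zero_le_one⟩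
  have := heq.closure ((continuous_iU_toForm A _).comp hy) ((continuous_iU_toForm B _).comp hy) h0
  simp only [hy0] at this
  exact this

theorem stmt3 (n k r : ℕ) (hn : 1 ≤ n) (hk : k ≤ n) (hr : 1 ≤ r) :
    Set.BijOn (phiPullTS (n + 1) k) (PLmosim (n + 1) k (r : ℤ))
      ((fun γ => bubbleSmul (n + 1) k
          (castFormOn (show (n + 1) - (1 + (n - k)) = k by omega)
            (starSph (n + 1) (n - k) γ))) ''
        {γ ∈ PLsph (n + 1) (n - k) (2 * (r : ℤ) + k - n - 2) | IsEvenSph (n + 1) (n - k) γ}) ∧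
    (∀ a b, phiPullTS (n + 1) k (a + b) = phiPullTS (n + 1) k a + phiPullTS (n + 1) k b) ∧
    (∀ (c : ℝ) a, phiPullTS (n + 1) k (c • a) = c • phiPullTS (n + 1) k a) := by
  have hdeg : (2 * r + k - (n + 1 : ℕ) - 1 : ℤ) = 2 * (r : ℤ) + k - n - 2 := by push_cast; ring
  have hdim : n - k + (k + 1) = n + 1 := by omega
  refine ⟨⟨fun a ha => ?_, (injOn_phiPullTS n.succ_pos _).mono fun a ha => ha.1, ?_⟩,
    fun _ _ => rfl, fun _ _ => rfl⟩
  · obtain ⟨ζ, hζ, ho, he⟩ := exists_odd_of_mem_PLmosim n.succ_pos hr ha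
    rw [hdeg] at hζ
    obtain ⟨γ, hγ, hγe, hs⟩ := exists_even_of_odd hdim (by omega) hζ ho
    refine ⟨γ, ⟨hγ, hγe⟩, ?_⟩
    funext u
    ext w
    rw [he, ← hs]
    rfl
  · rintro _ ⟨γ, ⟨hγ, hγe⟩, rfl⟩
    obtain ⟨ζ, hζ, ho, hs⟩ := exists_odd_of_even hdim (by omega) hγ hγe
    rw [← hdeg] at hζ
    obtain ⟨a, ha, he⟩ := exists_mem_PLmosim_of_odd hζ ho
    refine ⟨a, ha, ?_⟩
    funext u
    ext w
    rw [he, ← hs]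
    rfl

end
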